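/- arXiv:1511.02261 — 2 statements merged into one kernel-verified Lean document; each statement's English description precedes it below -/
import Mathlib

section
/- Let {P0=0} and {P1=0} be two nonsingular real algebraic curves of bidegree (k,l) in (CP^1)^2 intersecting transversely in 2kl points, and let D be an irreducible real algebraic curve of bidegree (4k,4l) in (CP^1)^2 with exactly 2kl ordinary double points, one at each intersection point of {P0=0} and {P1=0}. Let {P=0} be the real algebraic surface of tridegree (k,l,1) in (CP^1)^3 defined by P = v3 P1 + u3 P0, which is the blow-up of (CP^1)^2 at the 2kl intersection points. Then there exists a real algebraic surface {Q=0} of tridegree (2k,2l,2) in (CP^1)^3 such that the strict transform of D in {P=0} is the intersection {P=0} cap {Q=0}. -/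
open MvPolynomial

abbrev CP1 := Projectivization ℂ (Fin 2 → ℂ)

noncomputable instance : TopologicalSpace CP1 :=
  inferInstanceAs (TopologicalSpace (Quotient _))

abbrev TriPoly := MvPolynomial (Fin 3 × Fin 2) ℝ
abbrev BiPoly := MvPolynomial (Fin 2 × Fin 2) ℝ

def IsTriHomogeneous (P : TriPoly) (d : Fin 3 → ℤ) : Prop :=
  ∀ m ∈ P.support, ∀ i : Fin 3, (m (i, 0) : ℤ) + (m (i, 1) : ℤ) = d i

def IsBiHomogeneous (P : BiPoly) (d : Fin 2 → ℤ) : Prop :=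
  ∀ m ∈ P.support, ∀ i : Fin 2, (m (i, 0) : ℤ) + (m (i, 1) : ℤ) = d i

def ComplexLocus (P : TriPoly) : Set (Fin 3 → CP1) :=
  {x | eval (fun p : Fin 3 × Fin 2 => (x p.1).rep p.2) (P.map (algebraMap ℝ ℂ)) = 0}

def CurveComplexLocus (P : BiPoly) : Set (Fin 2 → CP1) :=
  {x | eval (fun p : Fin 2 × Fin 2 => (x p.1).rep p.2) (P.map (algebraMap ℝ ℂ)) = 0}

def IsNonsingularCurve (P : BiPoly) : Prop :=
  ∀ v : Fin 2 × Fin 2 → ℂ, (∀ i : Fin 2, (fun j => v (i, j)) ≠ 0) →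
    eval v (P.map (algebraMap ℝ ℂ)) = 0 →
    ∃ p : Fin 2 × Fin 2, eval v ((pderiv p P).map (algebraMap ℝ ℂ)) ≠ 0

def MeetTransversally (P Q : BiPoly) : Prop :=
  ∀ v : Fin 2 × Fin 2 → ℂ, (∀ i : Fin 2, (fun j => v (i, j)) ≠ 0) →
    eval v (P.map (algebraMap ℝ ℂ)) = 0 → eval v (Q.map (algebraMap ℝ ℂ)) = 0 →
    LinearIndependent ℂ
      ![fun p => eval v ((pderiv p P).map (algebraMap ℝ ℂ)),
        fun p => eval v ((pderiv p Q).map (algebraMap ℝ ℂ))]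

/-- `v` is a cone point of an ordinary double point (node) of the curve `{D = 0}`:
the polynomial and its first partial derivatives vanish at `v`, while the Hessian has
rank `2` (its kernel being exactly the 2-dimensional Euler subspace). -/
noncomputable def IsNodeCone (D : BiPoly) (v : Fin 2 × Fin 2 → ℂ) : Prop :=
  (∀ i : Fin 2, (fun j => v (i, j)) ≠ 0) ∧
  eval v (D.map (algebraMap ℝ ℂ)) = 0 ∧
  (∀ p, eval v ((pderiv p D).map (algebraMap ℝ ℂ)) = 0) ∧
  (Matrix.of fun p q : Fin 2 × Fin 2 =>
    eval v ((pderiv p (pderiv q D)).map (algebraMap ℝ ℂ))).rank = 2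

section MultiHomogeneous

variable {ι : Type*} [DecidableEq ι] {K : Type*} [Field K]

/-- The weights recording the multidegree in blocks of two variables. -/
def blockWeight (p : ι × Fin 2) : ι → ℕ := Pi.single p.1 1

lemma weight_blockWeight (m : ι × Fin 2 →₀ ℕ) (i : ι) :
    Finsupp.weight blockWeight m i = m (i, 0) + m (i, 1) := by
  induction m using Finsupp.induction_linear with
  | zero => simp
  | add f g hf hg => simp only [map_add, Pi.add_apply, hf, hg, Finsupp.add_apply]; ring
  | single p n =>
    obtain ⟨j, b⟩ := p
    rw [Finsupp.weight_single]
    by_cases h : j = i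
    · subst h
      fin_cases b <;> simp [blockWeight]
    · simp [blockWeight, Ne.symm h]

lemma weight_blockWeight_apply (m : ι × Fin 2 →₀ ℕ) (i : ι) :
    Finsupp.weight (fun p : ι × Fin 2 => blockWeight p i) m = m (i, 0) + m (i, 1) := by
  rw [← weight_blockWeight, Finsupp.weight_apply, Finsupp.weight_apply, Finsupp.sum, Finsupp.sum,
    Finset.sum_apply]
  rfl

lemma MvPolynomial.IsWeightedHomogeneous.block {f : MvPolynomial (ι × Fin 2) K} {d : ι → ℕ}
    (hf : IsWeightedHomogeneous blockWeight f d) (i : ι) :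
    IsWeightedHomogeneous (fun p : ι × Fin 2 => blockWeight p i) f (d i) := by
  intro m hm
  rw [weight_blockWeight_apply, ← weight_blockWeight, hf hm]

lemma isWeightedHomogeneous_blockWeight_iff {f : MvPolynomial (ι × Fin 2) K} {d : ι → ℕ} :
    IsWeightedHomogeneous blockWeight f d ↔
      ∀ m ∈ f.support, ∀ i, m (i, 0) + m (i, 1) = d i := by
  refine ⟨fun h m hm i => ?_, fun h m hm => ?_⟩
  · rw [← weight_blockWeight, h (mem_support_iff.1 hm)]
  · funext i
    rw [weight_blockWeight, h m (mem_support_iff.2 hm)]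

lemma aeval_mul_of_prod_eq {σ A : Type*} [CommRing A] [Algebra K A] {f : MvPolynomial σ K}
    {s g : σ → A} {t : A} (h : ∀ m ∈ f.support, m.prod (fun p n => s p ^ n) = t) :
    aeval (fun p => s p * g p) f = t * aeval g f := by
  rw [aeval_def, eval₂_eq, aeval_def, eval₂_eq, Finset.mul_sum]
  refine Finset.sum_congr rfl fun m hm => ?_
  rw [← h m hm, Finsupp.prod]
  simp only [mul_pow, Finset.prod_mul_distrib]
  ring

/-- Scaling the variables of one block. -/
lemma aeval_block_scale {A : Type*} [CommRing A] [Algebra K A] {f : MvPolynomial (ι × Fin 2) K}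
    {i : ι} {d : ℕ} (hf : IsWeightedHomogeneous (fun p : ι × Fin 2 => blockWeight p i) f d)
    (t : A) (g : ι × Fin 2 → A) :
    aeval (fun p => t ^ blockWeight p i * g p) f = t ^ d * aeval g f := by
  refine aeval_mul_of_prod_eq fun m hm => ?_
  rw [← hf (mem_support_iff.1 hm), Finsupp.weight_apply, Finsupp.prod, Finsupp.sum,
    ← Finset.prod_pow_eq_pow_sum]
  refine Finset.prod_congr rfl fun p _ => ?_
  rw [← pow_mul, smul_eq_mul, mul_comm]

/-- Scaling the variables of all blocks. -/
lemma aeval_scale [Fintype ι] {A : Type*} [CommRing A] [Algebra K A]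
    {f : MvPolynomial (ι × Fin 2) K} {d : ι → ℕ} (hf : IsWeightedHomogeneous blockWeight f d)
    (c : ι → A) (g : ι × Fin 2 → A) :
    aeval (fun p => c p.1 * g p) f = (∏ i, c i ^ d i) * aeval g f := by
  refine aeval_mul_of_prod_eq fun m hm => ?_
  rw [Finsupp.prod_fintype _ _ (by simp), Fintype.prod_prod_type]
  refine Finset.prod_congr rfl fun i _ => ?_
  rw [Fin.prod_univ_two, ← pow_add, isWeightedHomogeneous_blockWeight_iff.1 hf m hm]

lemma isWeightedHomogeneous_blockWeight_X (p : ι × Fin 2) :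
    IsWeightedHomogeneous blockWeight (X p : MvPolynomial (ι × Fin 2) K) (Pi.single p.1 1) :=
  isWeightedHomogeneous_X K _ p

/-- The linear form in the variables of block `i` vanishing at `a`. -/
noncomputable def blockForm (i : ι) (a : Fin 2 → K) : MvPolynomial (ι × Fin 2) K :=
  C (a 1) * X (i, 0) - C (a 0) * X (i, 1)

/-- The linear form in the variables of block `i` with coefficients `c`. -/
noncomputable def blockLinear (i : ι) (c : Fin 2 → K) : MvPolynomial (ι × Fin 2) K :=
  C (c 0) * X (i, 0) + C (c 1) * X (i, 1)

lemma blockForm_isWeightedHomogeneous (i : ι) (a : Fin 2 → K) :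
    IsWeightedHomogeneous blockWeight (blockForm i a) (Pi.single i 1) :=
  ((isWeightedHomogeneous_blockWeight_X _).C_mul _).sub
    ((isWeightedHomogeneous_blockWeight_X _).C_mul _)

lemma blockLinear_isWeightedHomogeneous (i : ι) (c : Fin 2 → K) :
    IsWeightedHomogeneous blockWeight (blockLinear i c) (Pi.single i 1) :=
  ((isWeightedHomogeneous_blockWeight_X _).C_mul _).add
    ((isWeightedHomogeneous_blockWeight_X _).C_mul _)

/-- Substitution of constants for the variables of block `i`. -/
noncomputable def blockSubst (i : ι) (a : Fin 2 → K) :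
    MvPolynomial (ι × Fin 2) K →ₐ[K] MvPolynomial (ι × Fin 2) K :=
  aeval fun p => if p.1 = i then C (a p.2) else X p

lemma eval_blockSubst (i : ι) (a : Fin 2 → K) (v : ι × Fin 2 → K)
    (f : MvPolynomial (ι × Fin 2) K) :
    eval v (blockSubst i a f) = eval (fun p => if p.1 = i then a p.2 else v p) f := by
  have : (eval v).comp (blockSubst i a : MvPolynomial (ι × Fin 2) K →+* _) =
      eval (fun p => if p.1 = i then a p.2 else v p) := by
    ext p
    · simp
    · simp only [blockSubst, RingHom.comp_apply, RingHom.coe_coe, aeval_X, eval_X]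
      split_ifs <;> simp
  exact congrArg (fun g => g f) this

lemma blockSubst_blockForm (i : ι) (a : Fin 2 → K) : blockSubst i a (blockForm i a) = 0 := by
  simp [blockSubst, blockForm, mul_comm]

lemma blockForm_dvd_sub {i : ι} {d : ℕ} {a c : Fin 2 → K} (h : c 0 * a 0 + c 1 * a 1 = 1)
    {f : MvPolynomial (ι × Fin 2) K}
    (hf : IsWeightedHomogeneous (fun p : ι × Fin 2 => blockWeight p i) f d) :
    blockForm i a ∣ f - blockLinear i c ^ d * blockSubst i a f := by
  rw [← Ideal.mem_span_singleton, ← Ideal.Quotient.eq]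
  set I := Ideal.span {blockForm i a}
  let π := Ideal.Quotient.mkₐ K I
  have hπ : π = aeval (fun p => π (blockLinear i c) ^ blockWeight p i *
      π (if p.1 = i then C (a p.2) else X p)) := by
    ext p : 1
    rw [aeval_X]
    obtain ⟨j, b⟩ := p
    by_cases hj : j = i
    · subst hj
      simp only [blockWeight, Pi.single_eq_same, pow_one, if_true, ← map_mul]
      refine Ideal.Quotient.eq.2 (Ideal.mem_span_singleton.2 ?_)
      have hC : (C (c 0) * C (a 0) + C (c 1) * C (a 1) : MvPolynomial (ι × Fin 2) K) = 1 := by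
        rw [← C_mul, ← C_mul, ← C_add, h, C_1]
      fin_cases b
      · refine ⟨C (c 1), ?_⟩
        simp only [blockLinear, blockForm, Fin.zero_eta]
        linear_combination -X (j, 0) * hC
      · refine ⟨-C (c 0), ?_⟩
        simp only [blockLinear, blockForm, Fin.mk_one]
        linear_combination -X (j, 1) * hC
    · simp [blockWeight, hj, Ne.symm hj]
  have h1 : π f = π (blockLinear i c) ^ d *
      aeval (fun p : ι × Fin 2 => π (if p.1 = i then C (a p.2) else X p)) f := by
    conv_lhs => rw [hπ]
    exact aeval_block_scale hf _ _
  change π f = π _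
  rw [h1, map_mul, map_pow, blockSubst]
  congr 1
  rw [← AlgHom.comp_apply, comp_aeval]

lemma weightedHomogeneousComponent_mul {σ M : Type*} [AddCancelCommMonoid M]
    {w : σ → M} {g : MvPolynomial σ K} {e : M}
    (hg : IsWeightedHomogeneous w g e) (d : M) (f : MvPolynomial σ K) :
    weightedHomogeneousComponent w (d + e) (f * g) = weightedHomogeneousComponent w d f * g := by
  classical
  conv_lhs => rw [← finsum_weightedHomogeneousComponent w f]
  rw [finsum_mul' _ _ (weightedHomogeneousComponent_finsupp f),
    map_finsum _ ((weightedHomogeneousComponent_finsupp (w := w) f).subset ?_)]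
  · rw [finsum_eq_single _ d]
    · exact weightedHomogeneousComponent_eq_self
        ((weightedHomogeneousComponent_isWeightedHomogeneous d f).mul hg)
    · intro n hn
      exact ((weightedHomogeneousComponent_isWeightedHomogeneous n f).mul
        hg).weightedHomogeneousComponent_ne _ fun h => hn (add_right_cancel h).symm
  · intro m hm hm0
    exact hm (by simp [hm0])

end MultiHomogeneous

section Codimension

variable {K : Type*} [Field K]

lemma exists_linear_form_ne_zero {σ : Type*} [Fintype σ] [Infinite K] (T : Finset (σ → K))
    (hT : ∀ x ∈ T, x ≠ 0) (h : MvPolynomial σ K) (hh : h ≠ 0) :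
    ∃ v, eval v h ≠ 0 ∧ ∀ x ∈ T, x ⬝ᵥ v ≠ 0 := by
  classical
  have hne : h * ∏ x ∈ T, ∑ p, C (x p) * (X p : MvPolynomial σ K) ≠ 0 := by
    refine mul_ne_zero hh (Finset.prod_ne_zero_iff.2 fun x hx h0 => hT x hx ?_)
    funext p
    have := congrArg (eval (Pi.single p 1)) h0
    simpa [Pi.single_apply] using this
  obtain ⟨v, hv⟩ : ∃ v, eval v (h * ∏ x ∈ T, ∑ p, C (x p) * (X p : MvPolynomial σ K)) ≠ 0 := by
    by_contra! hc
    exact hne (MvPolynomial.funext fun v => by rw [hc v, map_zero])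
  rw [map_mul, map_prod] at hv
  refine ⟨v, left_ne_zero_of_mul hv, fun x hx => ?_⟩
  have := Finset.prod_ne_zero_iff.1 (right_ne_zero_of_mul hv) x hx
  simpa [dotProduct] using this

/-- A polynomial whose zeros lie in finitely many linear subspaces of codimension two is a unit. -/
lemma isUnit_of_zeros_subset_codim_two {σ : Type*} [Fintype σ] [IsAlgClosed K]
    (T : Finset ((σ → K) × (σ → K)))
    (hT : ∀ x ∈ T, LinearIndependent K ![x.1, x.2]) (h : MvPolynomial σ K)
    (hz : ∀ v, eval v h = 0 → ∃ x ∈ T, x.1 ⬝ᵥ v = 0 ∧ x.2 ⬝ᵥ v = 0) : IsUnit h := by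
  classical
  have : Infinite K := IsAlgClosed.instInfinite
  obtain ⟨v, -, hv⟩ := exists_linear_form_ne_zero (T.image Prod.fst) (by
    intro x hx
    obtain ⟨y, hy, rfl⟩ := Finset.mem_image.1 hx
    exact (hT y hy).ne_zero 0) (1 : MvPolynomial σ K) one_ne_zero
  have hv1 : ∀ x ∈ T, x.1 ⬝ᵥ v ≠ 0 := fun x hx => hv _ (Finset.mem_image_of_mem _ hx)
  have hv0 : eval v h ≠ 0 := fun h0 => by
    obtain ⟨x, hx, h1, -⟩ := hz v h0
    exact hv1 x hx h1
  suffices hC : h - C (eval v h) = 0 by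
    rw [sub_eq_zero.1 hC]
    exact (isUnit_iff_ne_zero.2 hv0).map C
  by_contra hne
  obtain ⟨w, hw, hwT⟩ := exists_linear_form_ne_zero
    (T.image fun x => (x.1 ⬝ᵥ v) • x.2 - (x.2 ⬝ᵥ v) • x.1) (by
      intro x hx h0
      obtain ⟨y, hy, rfl⟩ := Finset.mem_image.1 hx
      have := (LinearIndependent.pair_iff.1 (hT y hy)) (-(y.2 ⬝ᵥ v)) (y.1 ⬝ᵥ v) (by
        rw [← h0]; module)
      exact hv1 y hy this.2) _ hne
  let line : Polynomial K := aeval (fun p => Polynomial.C (v p) + Polynomial.X *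
    Polynomial.C (w p - v p)) h
  have hline : ∀ t, line.eval t = eval (v + t • (w - v)) h := by
    intro t
    change (Polynomial.evalRingHom t) (aeval _ h) = _
    rw [aeval_def, hom_eval₂]
    change eval₂ _ _ h = eval₂ _ _ h
    congr 1
    · ext; simp
    · funext p; simp
  have hroot : ∀ t, ¬ line.IsRoot t := by
    intro t ht
    rw [Polynomial.IsRoot, hline] at ht
    obtain ⟨x, hx, h1, h2⟩ := hz _ ht
    have hx' := hwT _ (Finset.mem_image_of_mem _ hx)
    simp only [dotProduct_add, dotProduct_smul, dotProduct_sub, sub_dotProduct, smul_dotProduct,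
      smul_eq_mul] at h1 h2 hx'
    have ht0 : t ≠ 0 := by
      rintro rfl
      exact hv1 x hx (by simpa using h1)
    refine hx' (mul_left_cancel₀ ht0 ?_)
    linear_combination (x.1 ⬝ᵥ v) * h2 - (x.2 ⬝ᵥ v) * h1
  have hdeg : line.degree = 0 := by
    by_contra hd
    exact (IsAlgClosed.exists_root line hd).elim fun t => hroot t
  have hconst := Polynomial.eq_C_of_degree_le_zero hdeg.le
  refine hw ?_
  have h0 := hline 0
  have h1 := hline 1
  rw [hconst, Polynomial.eval_C] at h0 h1
  simp only [zero_smul, add_zero, one_smul, add_sub_cancel] at h0 h1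
  simp [← h0, ← h1]

end Codimension

section MaxNoether

variable {K : Type*} [Field K]

/-- The finite set `Z` represents, without repetition, the common zeros in the product of two
projective lines of the forms `p` and `q`. -/
structure RepresentsCommonZeros (p q : MvPolynomial (Fin 2 × Fin 2) K)
    (Z : Finset (Fin 2 × Fin 2 → K)) : Prop where
  ne_zero : ∀ z ∈ Z, ∀ i, (fun j => z (i, j)) ≠ 0
  eval_fst : ∀ z ∈ Z, eval z p = 0
  eval_snd : ∀ z ∈ Z, eval z q = 0
  separated : ∀ z ∈ Z, ∀ z' ∈ Z, z ≠ z' → ∃ i, z' (i, 1) * z (i, 0) ≠ z' (i, 0) * z (i, 1)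
  exhaustive : ∀ v : Fin 2 × Fin 2 → K, (∀ i, (fun j => v (i, j)) ≠ 0) → eval v p = 0 →
    eval v q = 0 → ∃ z ∈ Z, ∀ i, z (i, 1) * v (i, 0) = z (i, 0) * v (i, 1)

/-- The coefficients of the linear form `b 0 * u + b 1 * v` in the block `i`. -/
def blockCoeff (i : Fin 2) (b : Fin 2 → K) : Fin 2 × Fin 2 → K :=
  fun p => if p.1 = i then b p.2 else 0

lemma blockCoeff_dotProduct (i : Fin 2) (b : Fin 2 → K) (v : Fin 2 × Fin 2 → K) :
    blockCoeff i b ⬝ᵥ v = b 0 * v (i, 0) + b 1 * v (i, 1) := by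
  simp [dotProduct, blockCoeff, Fintype.sum_prod_type]

lemma linearIndependent_blockCoeff_same (i : Fin 2) :
    LinearIndependent K ![blockCoeff i ![(1 : K), 0], blockCoeff i ![0, 1]] := by
  refine LinearIndependent.pair_iff.2 fun s t h => ⟨?_, ?_⟩
  · simpa [blockCoeff] using congrFun h (i, 0)
  · simpa [blockCoeff] using congrFun h (i, 1)

lemma linearIndependent_blockCoeff {b c : Fin 2 → K} (hb : b ≠ 0) (hc : c ≠ 0) :
    LinearIndependent K ![blockCoeff 0 b, blockCoeff 1 c] := by
  obtain ⟨i, hi⟩ := Function.ne_iff.1 hb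
  obtain ⟨j, hj⟩ := Function.ne_iff.1 hc
  refine LinearIndependent.pair_iff.2 fun s t h => ⟨?_, ?_⟩
  · simpa [blockCoeff, show b i ≠ 0 from hi] using congrFun h (0, i)
  · simpa [blockCoeff, show c j ≠ 0 from hj] using congrFun h (1, j)

lemma block_eq_zero_iff (v : Fin 2 × Fin 2 → K) (i : Fin 2) :
    (fun j => v (i, j)) = 0 ↔ v (i, 0) = 0 ∧ v (i, 1) = 0 := by
  simp [funext_iff, Fin.forall_fin_two]

lemma RepresentsCommonZeros.isRelPrime [IsAlgClosed K] {p q : MvPolynomial (Fin 2 × Fin 2) K}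
    {Z : Finset (Fin 2 × Fin 2 → K)} (hZ : RepresentsCommonZeros p q Z) : IsRelPrime p q := by
  classical
  intro h hp hq
  refine isUnit_of_zeros_subset_codim_two
    (Finset.univ.image (fun i => (blockCoeff i ![(1 : K), 0], blockCoeff i ![0, 1])) ∪
      Z.image fun z => (blockCoeff 0 ![z (0, 1), -z (0, 0)], blockCoeff 1 ![z (1, 1), -z (1, 0)]))
    ?_ h ?_
  · intro x hx
    rcases Finset.mem_union.1 hx with hx | hx
    · obtain ⟨i, -, rfl⟩ := Finset.mem_image.1 hx
      exact linearIndependent_blockCoeff_same i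
    · obtain ⟨z, hz, rfl⟩ := Finset.mem_image.1 hx
      have key : ∀ i, ![z (i, 1), -z (i, 0)] ≠ 0 := fun i h0 => hZ.ne_zero z hz i <| by
        rw [block_eq_zero_iff]
        exact ⟨by simpa using congrFun h0 1, by simpa using congrFun h0 0⟩
      exact linearIndependent_blockCoeff (key 0) (key 1)
  · intro v hv
    have hp0 : eval v p = 0 := by
      obtain ⟨r, rfl⟩ := hp
      rw [map_mul, hv, zero_mul]
    have hq0 : eval v q = 0 := by
      obtain ⟨r, rfl⟩ := hq
      rw [map_mul, hv, zero_mul]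
    by_cases hb : ∀ i, (fun j => v (i, j)) ≠ 0
    · obtain ⟨z, hz, hzv⟩ := hZ.exhaustive v hb hp0 hq0
      refine ⟨_, Finset.mem_union_right _ (Finset.mem_image_of_mem _ hz), ?_, ?_⟩
      · simpa [blockCoeff_dotProduct, ← sub_eq_add_neg, sub_eq_zero] using hzv 0
      · simpa [blockCoeff_dotProduct, ← sub_eq_add_neg, sub_eq_zero] using hzv 1
    · push Not at hb
      obtain ⟨i, hi⟩ := hb
      rw [block_eq_zero_iff] at hi
      refine ⟨_, Finset.mem_union_left _ (Finset.mem_image_of_mem _ (Finset.mem_univ i)), ?_, ?_⟩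
      · simp [blockCoeff_dotProduct, hi.1]
      · simp [blockCoeff_dotProduct, hi.2]

lemma RepresentsCommonZeros.isRelPrime_blockSubst [IsAlgClosed K]
    {p q : MvPolynomial (Fin 2 × Fin 2) K}
    {Z : Finset (Fin 2 × Fin 2 → K)} (hZ : RepresentsCommonZeros p q Z) {i : Fin 2}
    {a : Fin 2 → K} (ha : a ≠ 0) (haZ : ∀ z ∈ Z, z (i, 1) * a 0 ≠ z (i, 0) * a 1) :
    IsRelPrime (blockSubst i a p) (blockSubst i a q) := by
  classical
  intro h hp hq
  obtain ⟨k, hk⟩ : ∃ k : Fin 2, k ≠ i := exists_ne i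
  refine isUnit_of_zeros_subset_codim_two
    {(blockCoeff k ![(1 : K), 0], blockCoeff k ![0, 1])} ?_ h ?_
  · intro x hx
    rw [Finset.mem_singleton.1 hx]
    exact linearIndependent_blockCoeff_same k
  · intro v hv
    refine ⟨_, Finset.mem_singleton_self _, ?_⟩
    by_contra hne
    have hp0 : eval v (blockSubst i a p) = 0 := by
      obtain ⟨r, hr⟩ := hp
      rw [hr, map_mul, hv, zero_mul]
    have hq0 : eval v (blockSubst i a q) = 0 := by
      obtain ⟨r, hr⟩ := hq
      rw [hr, map_mul, hv, zero_mul]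
    rw [eval_blockSubst] at hp0 hq0
    obtain ⟨z, hz, hzv⟩ := hZ.exhaustive _ (by
      intro j
      by_cases hj : j = i
      · simpa [hj] using ha
      · have : j = k := by omega
        subst this
        simpa [hj, blockCoeff_dotProduct, funext_iff, Fin.forall_fin_two] using hne) hp0 hq0
    exact haZ z hz (by simpa using hzv i)

lemma IsRelPrime.exists_eq_mul_of_add_eq_zero {R : Type*} [CommRing R] [IsDomain R]
    [DecompositionMonoid R] {a b x y : R} (h : IsRelPrime a b) (hxy : x * a + y * b = 0) :
    ∃ r, x = r * b ∧ y = -r * a := by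
  by_cases hb : b = 0
  · subst hb
    obtain ⟨u, rfl⟩ := isRelPrime_zero_right.1 h
    exact ⟨-y * ↑u⁻¹, by simpa using hxy, by simp⟩
  · obtain ⟨r, rfl⟩ : b ∣ x := h.symm.dvd_of_dvd_mul_right ⟨-y, by linear_combination hxy⟩
    exact ⟨r, mul_comm _ _, mul_left_cancel₀ hb (by linear_combination hxy)⟩

lemma blockForm_ne_zero (i : Fin 2) {a : Fin 2 → K} (ha : a ≠ 0) :
    (blockForm i a : MvPolynomial (Fin 2 × Fin 2) K) ≠ 0 := by
  intro h
  refine ha (funext fun j => ?_)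
  have h0 := congrArg (eval (Pi.single (i, 0) 1)) h
  have h1 := congrArg (eval (Pi.single (i, 1) 1)) h
  simp only [blockForm, map_sub, map_mul, eval_C, eval_X, map_zero] at h0 h1
  fin_cases j
  · simpa using h1
  · simpa using h0

/-- Forms of large enough degree in block `i` that become members of the ideal `(p, q)` after
multiplication by a linear form in that block avoiding the common zeros were already members. -/
lemma RepresentsCommonZeros.mem_span_of_blockForm_mul_mem [IsAlgClosed K]
    {p q : MvPolynomial (Fin 2 × Fin 2) K} {e d : Fin 2 → ℕ}
    (hp : IsWeightedHomogeneous blockWeight p e) (hq : IsWeightedHomogeneous blockWeight q e)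
    {Z : Finset (Fin 2 × Fin 2 → K)} (hZ : RepresentsCommonZeros p q Z) {i : Fin 2}
    {a : Fin 2 → K} (ha : a ≠ 0) (haZ : ∀ z ∈ Z, z (i, 1) * a 0 ≠ z (i, 0) * a 1)
    {G : MvPolynomial (Fin 2 × Fin 2) K}
    (hG : IsWeightedHomogeneous blockWeight G (d + e + e))
    (hmem : ∃ f g, blockForm i a * G = f * p + g * q) : ∃ f g, G = f * p + g * q := by
  obtain ⟨f, g, hfg⟩ := hmem
  set d' : Fin 2 → ℕ := d + Pi.single i 1
  have hdeg : IsWeightedHomogeneous blockWeight (blockForm i a * G) (d' + e + e) := by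
    have := (blockForm_isWeightedHomogeneous i a).mul hG
    rwa [show Pi.single i 1 + (d + e + e) = d' + e + e by simp only [d']; abel] at this
  set f' := weightedHomogeneousComponent blockWeight (d' + e) f
  set g' := weightedHomogeneousComponent blockWeight (d' + e) g
  have hfg' : blockForm i a * G = f' * p + g' * q := by
    rw [← weightedHomogeneousComponent_mul hp, ← weightedHomogeneousComponent_mul hq, ← map_add,
      ← hfg, weightedHomogeneousComponent_eq_self hdeg]
  have hf' : IsWeightedHomogeneous blockWeight f' (d' + e) :=
    weightedHomogeneousComponent_isWeightedHomogeneous _ _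
  have hg' : IsWeightedHomogeneous blockWeight g' (d' + e) :=
    weightedHomogeneousComponent_isWeightedHomogeneous _ _
  have hrel := hZ.isRelPrime_blockSubst ha haZ
  obtain ⟨c, hc⟩ : ∃ c : Fin 2 → K, c 0 * a 0 + c 1 * a 1 = 1 := by
    obtain ⟨j, hj⟩ := Function.ne_iff.1 ha
    fin_cases j
    · exact ⟨![(a 0)⁻¹, 0], by simpa using inv_mul_cancel₀ hj⟩
    · exact ⟨![0, (a 1)⁻¹], by simpa using inv_mul_cancel₀ hj⟩
  have hsub := congrArg (blockSubst i a) hfg'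
  simp only [map_mul, map_add, blockSubst_blockForm, zero_mul] at hsub
  obtain ⟨r, hrf, hrg⟩ := hrel.exists_eq_mul_of_add_eq_zero hsub.symm
  set M : MvPolynomial (Fin 2 × Fin 2) K := blockLinear i c
  have hadd : ∀ x : MvPolynomial (Fin 2 × Fin 2) K,
      M ^ ((d' + e) i) * x = M ^ d' i * (M ^ e i * x) := fun x => by
    rw [Pi.add_apply, pow_add, mul_assoc]
  obtain ⟨f₁, hf₁⟩ := blockForm_dvd_sub hc (hf'.block i)
  obtain ⟨g₁, hg₁⟩ := blockForm_dvd_sub hc (hg'.block i)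
  obtain ⟨p₁, hp₁⟩ := blockForm_dvd_sub hc (hp.block i)
  obtain ⟨q₁, hq₁⟩ := blockForm_dvd_sub hc (hq.block i)
  rw [hrf, hadd] at hf₁
  rw [hrg, hadd] at hg₁
  refine ⟨f₁ - M ^ d' i * r * q₁, g₁ + M ^ d' i * r * p₁,
    mul_left_cancel₀ (blockForm_ne_zero i ha) ?_⟩
  linear_combination hfg' + p * hf₁ + q * hg₁ - M ^ d' i * r * p * hq₁ + M ^ d' i * r * q * hp₁

end MaxNoether

section DimensionCount

variable {K : Type*} [Field K]

/-- The exponents `u₁^t₁ v₁^(d₁ - t₁) u₂^t₂ v₂^(d₂ - t₂)` of the monomials of bidegree `d`. -/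
noncomputable def blockExponent (d : Fin 2 → ℕ) (t : ∀ i, Fin (d i + 1)) : Fin 2 × Fin 2 →₀ ℕ :=
  Finsupp.equivFunOnFinite.symm fun p => if p.2 = 0 then (t p.1 : ℕ) else d p.1 - t p.1

lemma blockExponent_injective (d : Fin 2 → ℕ) : Function.Injective (blockExponent d) := by
  intro t s h
  funext i
  have := DFunLike.congr_fun h (i, 0)
  exact Fin.ext (by simpa [blockExponent] using this)

lemma weight_blockExponent (d : Fin 2 → ℕ) (t : ∀ i, Fin (d i + 1)) :
    Finsupp.weight blockWeight (blockExponent d t) = d := by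
  funext i
  rw [weight_blockWeight]
  have := (t i).is_le
  simp [blockExponent, this]

lemma exists_blockExponent_eq {d : Fin 2 → ℕ} {m : Fin 2 × Fin 2 →₀ ℕ}
    (hm : Finsupp.weight blockWeight m = d) : ∃ t, blockExponent d t = m := by
  have hd : ∀ i, m (i, 0) + m (i, 1) = d i := fun i => by rw [← hm, weight_blockWeight]
  refine ⟨fun i => ⟨m (i, 0), by have := hd i; omega⟩, ?_⟩
  ext ⟨i, j⟩
  have := hd i
  fin_cases j
  · simp [blockExponent]
  · simp [blockExponent, ← this]

/-- Bihomogeneous forms are determined by their coefficients. -/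
noncomputable def bihomogeneousEquiv (d : Fin 2 → ℕ) :
    weightedHomogeneousSubmodule K (blockWeight (ι := Fin 2)) d ≃ₗ[K]
      ((∀ i, Fin (d i + 1)) → K) :=
  LinearEquiv.ofBijective
    (LinearMap.pi fun t => (lcoeff K (blockExponent d t)).domRestrict _) <| by
    constructor
    · rw [injective_iff_map_eq_zero]
      rintro ⟨f, hf⟩ h
      refine Subtype.ext (MvPolynomial.ext _ _ fun m => ?_)
      by_contra hm
      obtain ⟨t, rfl⟩ := exists_blockExponent_eq (hf hm)
      exact hm (congrFun h t)
    · classical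
      intro c
      refine ⟨⟨∑ t, monomial (blockExponent d t) (c t), Submodule.sum_mem _ fun t _ =>
        isWeightedHomogeneous_monomial _ _ _ (weight_blockExponent d t)⟩, ?_⟩
      funext s
      simp [lcoeff, coeff_monomial, (blockExponent_injective d).eq_iff]

instance (d : Fin 2 → ℕ) :
    Module.Finite K (weightedHomogeneousSubmodule K (blockWeight (ι := Fin 2)) d) :=
  Module.Finite.equiv (bihomogeneousEquiv d).symm

lemma finrank_bihomogeneous (d : Fin 2 → ℕ) :
    Module.finrank K (weightedHomogeneousSubmodule K (blockWeight (ι := Fin 2)) d) =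
      (d 0 + 1) * (d 1 + 1) := by
  rw [(bihomogeneousEquiv d).finrank_eq, Module.finrank_fintype_fun_eq_card, Fintype.card_pi]
  simp

/-- Multiplication by a bihomogeneous form. -/
noncomputable def mulBihomogeneous {p : MvPolynomial (Fin 2 × Fin 2) K} {e : Fin 2 → ℕ}
    (hp : IsWeightedHomogeneous blockWeight p e) (d : Fin 2 → ℕ) :
    weightedHomogeneousSubmodule K (blockWeight (ι := Fin 2)) d →ₗ[K]
      weightedHomogeneousSubmodule K (blockWeight (ι := Fin 2)) (d + e) :=
  (LinearMap.mulRight K p).restrict fun _ hf => IsWeightedHomogeneous.mul hf hp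

lemma exists_form_separating [Infinite K] {z : Fin 2 × Fin 2 → K}
    (hz : ∀ i, (fun j => z (i, j)) ≠ 0)
    (T : Finset (Fin 2 × Fin 2 → K))
    (hT : ∀ z' ∈ T, ∃ i, z' (i, 1) * z (i, 0) ≠ z' (i, 0) * z (i, 1)) :
    ∀ d : Fin 2 → ℕ, (∀ i, T.card ≤ d i) → ∃ f, IsWeightedHomogeneous blockWeight f d ∧
      eval z f ≠ 0 ∧ ∀ z' ∈ T, eval z' f = 0 := by
  classical
  induction T using Finset.induction_on with
  | empty =>
    intro d _
    have key : ∀ i, ∃ c : Fin 2 → K, c 0 * z (i, 0) + c 1 * z (i, 1) ≠ 0 := by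
      intro i
      obtain ⟨j, hj⟩ := Function.ne_iff.1 (hz i)
      fin_cases j
      · exact ⟨![1, 0], by simpa using hj⟩
      · exact ⟨![0, 1], by simpa using hj⟩
    choose c hc using key
    refine ⟨∏ i, blockLinear i (c i) ^ d i, ?_, ?_, by simp⟩
    · have := IsWeightedHomogeneous.prod Finset.univ (fun i => blockLinear i (c i) ^ d i) _
        fun i _ => (blockLinear_isWeightedHomogeneous i (c i)).pow (d i)
      convert this using 1
      funext i
      simp [Finset.sum_apply, Pi.single_apply]
    · rw [map_prod]
      refine Finset.prod_ne_zero_iff.2 fun i _ => ?_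
      rw [map_pow]
      exact pow_ne_zero _ (by simpa [blockLinear] using hc i)
  | insert w T hw ih =>
    intro d hd
    rw [Finset.card_insert_of_notMem hw] at hd
    obtain ⟨i, hi⟩ := hT w (Finset.mem_insert_self w T)
    obtain ⟨f, hf, hfz, hfT⟩ := ih (fun z' h => hT z' (Finset.mem_insert_of_mem h))
      (d - Pi.single i 1) fun j => by
        have := hd j
        by_cases hj : j = i
        · subst hj
          simp; omega
        · simp [hj]; omega
    refine ⟨f * blockForm i fun j => w (i, j), ?_, ?_, ?_⟩
    · have := hf.mul (blockForm_isWeightedHomogeneous i fun j => w (i, j))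
      rwa [tsub_add_cancel_of_le] at this
      intro j
      have := hd j
      by_cases hj : j = i
      · subst hj
        simp; omega
      · simp [hj]
    · rw [map_mul]
      exact mul_ne_zero hfz (by simpa [blockForm, sub_eq_zero] using hi)
    · intro z' hz'
      rw [map_mul]
      rcases Finset.mem_insert.1 hz' with rfl | h
      · simp [blockForm, mul_comm]
      · rw [hfT z' h, zero_mul]

/-- Evaluation of bihomogeneous forms at finitely many vectors. -/
noncomputable def evalBihomogeneous (d : Fin 2 → ℕ) (Z : Finset (Fin 2 × Fin 2 → K)) :
    weightedHomogeneousSubmodule K (blockWeight (ι := Fin 2)) d →ₗ[K] (Z → K) :=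
  LinearMap.pi fun z => (aeval (z : Fin 2 × Fin 2 → K)).toLinearMap.domRestrict _

lemma evalBihomogeneous_apply (d : Fin 2 → ℕ) (Z : Finset (Fin 2 × Fin 2 → K))
    (f : weightedHomogeneousSubmodule K (blockWeight (ι := Fin 2)) d) (z : Z) :
    evalBihomogeneous d Z f z = eval (z : Fin 2 × Fin 2 → K) (f : MvPolynomial _ K) := by
  simp [evalBihomogeneous, aeval_eq_eval]

lemma RepresentsCommonZeros.evalBihomogeneous_surjective [Infinite K]
    {p q : MvPolynomial (Fin 2 × Fin 2) K} {Z : Finset (Fin 2 × Fin 2 → K)}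
    (hZ : RepresentsCommonZeros p q Z) {d : Fin 2 → ℕ} (hd : ∀ i, Z.card ≤ d i) :
    Function.Surjective (evalBihomogeneous d Z) := by
  classical
  have key : ∀ z : Z, ∃ f : weightedHomogeneousSubmodule K (blockWeight (ι := Fin 2)) d,
      evalBihomogeneous d Z f = Pi.single z 1 := by
    rintro ⟨z, hz⟩
    obtain ⟨f, hf, hfz, hfT⟩ := exists_form_separating (hZ.ne_zero z hz) (Z.erase z)
      (fun z' h => hZ.separated z hz z' (Finset.mem_of_mem_erase h) (Finset.ne_of_mem_erase h).symm)
      d fun i => (Finset.card_le_card (Finset.erase_subset _ _)).trans (hd i)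
    refine ⟨⟨C (eval z f)⁻¹ * f, hf.C_mul _⟩, ?_⟩
    funext ⟨z', hz'⟩
    rw [evalBihomogeneous_apply]
    by_cases h : z' = z
    · subst h
      simp [hfz]
    · rw [Pi.single_eq_of_ne (by simpa using h)]
      simp [hfT z' (Finset.mem_erase.2 ⟨h, hz'⟩)]
  choose F hF using key
  intro t
  refine ⟨∑ z, t z • F z, ?_⟩
  rw [map_sum]
  simp only [map_smul, hF]
  funext z
  simp [Finset.sum_apply, Pi.single_apply]

/-- Max Noether's theorem in large bidegrees, by counting dimensions. -/
lemma RepresentsCommonZeros.mem_span_of_card_le [IsAlgClosed K]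
    {p q : MvPolynomial (Fin 2 × Fin 2) K} {e d : Fin 2 → ℕ}
    (hp : IsWeightedHomogeneous blockWeight p e) (hq : IsWeightedHomogeneous blockWeight q e)
    (hq0 : q ≠ 0)
    {Z : Finset (Fin 2 × Fin 2 → K)} (hZ : RepresentsCommonZeros p q Z)
    (hcard : Z.card = 2 * e 0 * e 1) (hd : ∀ i, Z.card ≤ d i)
    {G : MvPolynomial (Fin 2 × Fin 2) K}
    (hG : IsWeightedHomogeneous blockWeight G (d + e + e)) (hGZ : ∀ z ∈ Z, eval z G = 0) :
    ∃ f g, G = f * p + g * q := by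
  have : Infinite K := IsAlgClosed.instInfinite
  let Ψ := (mulBihomogeneous hp (d + e)).coprod (mulBihomogeneous hq (d + e))
  let Θ := (mulBihomogeneous hq d).prod (-mulBihomogeneous hp d)
  have hker : LinearMap.ker Ψ ≤ LinearMap.range Θ := by
    rintro ⟨⟨f, hf⟩, ⟨g, hg⟩⟩ h
    have h' : f * p + g * q = 0 := congrArg Subtype.val h
    obtain ⟨r, hrf, hrg⟩ := hZ.isRelPrime.exists_eq_mul_of_add_eq_zero h'
    set r' := weightedHomogeneousComponent blockWeight d r
    have hf' : f = r' * q := by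
      rw [← weightedHomogeneousComponent_mul hq, ← hrf, weightedHomogeneousComponent_eq_self hf]
    have hg' : g = -(r' * p) := mul_right_cancel₀ hq0 (by
      rw [hf'] at h'
      linear_combination h')
    exact ⟨⟨r', weightedHomogeneousComponent_isWeightedHomogeneous _ _⟩,
      Prod.ext (Subtype.ext hf'.symm) (Subtype.ext hg'.symm)⟩
  have hle : LinearMap.range Ψ ≤ LinearMap.ker (evalBihomogeneous (d + e + e) Z) := by
    rintro _ ⟨⟨f, g⟩, rfl⟩
    rw [LinearMap.mem_ker]
    funext z
    rw [evalBihomogeneous_apply]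
    change eval _ (f.1 * p + g.1 * q) = 0
    simp [hZ.eval_fst z z.2, hZ.eval_snd z z.2]
  have hΨ := Ψ.finrank_range_add_finrank_ker
  have hΘ := (Submodule.finrank_mono hker).trans Θ.finrank_range_le
  have hev := (evalBihomogeneous (d + e + e) Z).finrank_range_add_finrank_ker
  rw [LinearMap.range_eq_top.2 (hZ.evalBihomogeneous_surjective fun i => by
    simp only [Pi.add_apply]; have := hd i; omega), finrank_top,
    Module.finrank_fintype_fun_eq_card, Fintype.card_coe, hcard, finrank_bihomogeneous] at hev
  rw [Module.finrank_prod, finrank_bihomogeneous] at hΨ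
  rw [finrank_bihomogeneous] at hΘ
  simp only [Pi.add_apply] at hΨ hev
  have heq := Submodule.eq_of_le_of_finrank_le hle (by nlinarith)
  have hmem : (⟨G, hG⟩ : weightedHomogeneousSubmodule K (blockWeight (ι := Fin 2)) (d + e + e)) ∈
      LinearMap.ker (evalBihomogeneous (d + e + e) Z) := by
    rw [LinearMap.mem_ker]
    funext z
    rw [evalBihomogeneous_apply]
    exact hGZ z z.2
  rw [← heq] at hmem
  obtain ⟨⟨f, g⟩, h⟩ := hmem
  exact ⟨f, g, (congrArg Subtype.val h).symm⟩

/-- A linear form in the given block avoiding finitely many vectors. -/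
lemma exists_block_vector_avoiding [Infinite K] (i : Fin 2) (Z : Finset (Fin 2 × Fin 2 → K))
    (hZ : ∀ z ∈ Z, (fun j => z (i, j)) ≠ 0) :
    ∃ a : Fin 2 → K, a ≠ 0 ∧ ∀ z ∈ Z, z (i, 1) * a 0 ≠ z (i, 0) * a 1 := by
  classical
  obtain ⟨v, hv, hvT⟩ := exists_linear_form_ne_zero
    (insert ![1, 0] (Z.image fun z => ![z (i, 1), -z (i, 0)])) (by
      intro x hx
      rcases Finset.mem_insert.1 hx with rfl | hx
      · exact fun h => one_ne_zero (congrFun h 0)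
      · obtain ⟨z, hz, rfl⟩ := Finset.mem_image.1 hx
        refine fun h => hZ z hz ?_
        rw [block_eq_zero_iff]
        exact ⟨by simpa using congrFun h 1, by simpa using congrFun h 0⟩)
    (1 : MvPolynomial (Fin 2) K) one_ne_zero
  refine ⟨v, ?_, fun z hz h => ?_⟩
  · rintro rfl
    exact hvT _ (Finset.mem_insert_self _ _) (by simp)
  · refine hvT _ (Finset.mem_insert_of_mem (Finset.mem_image_of_mem _ hz)) ?_
    simp [dotProduct, h]

lemma RepresentsCommonZeros.mem_span_of_blockForm_pow_mul_mem [IsAlgClosed K]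
    {p q : MvPolynomial (Fin 2 × Fin 2) K} {e : Fin 2 → ℕ}
    (hp : IsWeightedHomogeneous blockWeight p e) (hq : IsWeightedHomogeneous blockWeight q e)
    {Z : Finset (Fin 2 × Fin 2 → K)} (hZ : RepresentsCommonZeros p q Z) {i : Fin 2}
    {a : Fin 2 → K} (ha : a ≠ 0) (haZ : ∀ z ∈ Z, z (i, 1) * a 0 ≠ z (i, 0) * a 1) (n : ℕ) :
    ∀ {d : Fin 2 → ℕ} {G : MvPolynomial (Fin 2 × Fin 2) K},
      IsWeightedHomogeneous blockWeight G (d + e + e) →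
      (∃ f g, blockForm i a ^ n * G = f * p + g * q) → ∃ f g, G = f * p + g * q := by
  induction n with
  | zero => intro d G _ h; simpa using h
  | succ n ih =>
    rintro d G hG ⟨f, g, h⟩
    refine hZ.mem_span_of_blockForm_mul_mem hp hq ha haZ hG (ih (d := d + Pi.single i 1) ?_
      ⟨f, g, by rw [← h]; ring⟩)
    have := (blockForm_isWeightedHomogeneous i a).mul hG
    rwa [show Pi.single i 1 + (d + e + e) = d + Pi.single i 1 + e + e by abel] at this

/-- Max Noether's theorem on the product of two projective lines. -/
lemma RepresentsCommonZeros.exists_eq_mul_add_mul [IsAlgClosed K]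
    {p q : MvPolynomial (Fin 2 × Fin 2) K} {e d : Fin 2 → ℕ}
    (hp : IsWeightedHomogeneous blockWeight p e) (hq : IsWeightedHomogeneous blockWeight q e)
    (hq0 : q ≠ 0)
    {Z : Finset (Fin 2 × Fin 2 → K)} (hZ : RepresentsCommonZeros p q Z)
    (hcard : Z.card = 2 * e 0 * e 1)
    {G : MvPolynomial (Fin 2 × Fin 2) K}
    (hG : IsWeightedHomogeneous blockWeight G (d + e + e)) (hGZ : ∀ z ∈ Z, eval z G = 0) :
    ∃ f g, IsWeightedHomogeneous blockWeight f (d + e) ∧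
      IsWeightedHomogeneous blockWeight g (d + e) ∧ G = f * p + g * q := by
  have : Infinite K := IsAlgClosed.instInfinite
  choose a ha haZ using fun i => exists_block_vector_avoiding i Z fun z hz => hZ.ne_zero z hz i
  have h0 : IsWeightedHomogeneous blockWeight (blockForm 0 (a 0) ^ Z.card * G)
      (d + Z.card • Pi.single 0 1 + e + e) := by
    have := ((blockForm_isWeightedHomogeneous 0 (a 0)).pow Z.card).mul hG
    convert this using 1
    abel
  have h1 : IsWeightedHomogeneous blockWeight
      (blockForm 1 (a 1) ^ Z.card * (blockForm 0 (a 0) ^ Z.card * G))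
      (d + Z.card • Pi.single 0 1 + Z.card • Pi.single 1 1 + e + e) := by
    have := ((blockForm_isWeightedHomogeneous 1 (a 1)).pow Z.card).mul h0
    convert this using 1
    abel
  obtain ⟨f, g, hfg⟩ := hZ.mem_span_of_blockForm_pow_mul_mem hp hq (ha 0) (haZ 0) Z.card hG
    (hZ.mem_span_of_blockForm_pow_mul_mem hp hq (ha 1) (haZ 1) Z.card h0
      (hZ.mem_span_of_card_le hp hq hq0 hcard (fun i => by fin_cases i <;> simp) h1
        fun z hz => by rw [map_mul, map_mul, hGZ z hz, mul_zero, mul_zero]))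
  refine ⟨_, _, weightedHomogeneousComponent_isWeightedHomogeneous _ f,
    weightedHomogeneousComponent_isWeightedHomogeneous _ g, ?_⟩
  rw [← weightedHomogeneousComponent_mul hp, ← weightedHomogeneousComponent_mul hq, ← map_add,
    ← hfg, weightedHomogeneousComponent_eq_self hG]

end DimensionCount

section DoublePoints

/-- A form singular at the common zeros of two transversal forms `p`, `q` is a quadratic form in
`p` and `q`. -/
lemma RepresentsCommonZeros.exists_eq_quadratic {K : Type*} [Field K] [IsAlgClosed K]
    {p q : MvPolynomial (Fin 2 × Fin 2) K} {e : Fin 2 → ℕ}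
    (hp : IsWeightedHomogeneous blockWeight p e) (hq : IsWeightedHomogeneous blockWeight q e)
    (hq0 : q ≠ 0)
    {Z : Finset (Fin 2 × Fin 2 → K)} (hZ : RepresentsCommonZeros p q Z)
    (hcard : Z.card = 2 * e 0 * e 1)
    (hind : ∀ z ∈ Z, LinearIndependent K
      ![fun x => eval z (pderiv x p), fun x => eval z (pderiv x q)])
    {G : MvPolynomial (Fin 2 × Fin 2) K}
    (hG : IsWeightedHomogeneous blockWeight G (e + e + e + e)) (hGZ : ∀ z ∈ Z, eval z G = 0)
    (hGZ' : ∀ z ∈ Z, ∀ x, eval z (pderiv x G) = 0) :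
    ∃ A B C, IsWeightedHomogeneous blockWeight A (e + e) ∧
      IsWeightedHomogeneous blockWeight B (e + e) ∧
      IsWeightedHomogeneous blockWeight C (e + e) ∧
      G = A * p ^ 2 + B * (p * q) + C * q ^ 2 := by
  obtain ⟨f, g, hf, hg, rfl⟩ := hZ.exists_eq_mul_add_mul hp hq hq0 hcard hG hGZ
  have key : ∀ z ∈ Z, eval z f = 0 ∧ eval z g = 0 := by
    intro z hz
    refine LinearIndependent.pair_iff.1 (hind z hz) _ _ (funext fun x => ?_)
    have := hGZ' z hz x
    simpa [Derivation.leibniz, hZ.eval_fst z hz, hZ.eval_snd z hz] using this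
  obtain ⟨f₀, f₁, hf₀, hf₁, hfe⟩ :=
    hZ.exists_eq_mul_add_mul hp hq hq0 hcard hf fun z hz => (key z hz).1
  obtain ⟨g₀, g₁, hg₀, hg₁, hge⟩ :=
    hZ.exists_eq_mul_add_mul hp hq hq0 hcard hg fun z hz => (key z hz).2
  exact ⟨f₀, f₁ + g₀, g₁, hf₀, hf₁.add hg₀, hg₁, by rw [hfe, hge]; ring⟩

lemma exists_map_add_I_mul_map {σ : Type*} (f : MvPolynomial σ ℂ) :
    ∃ a b : MvPolynomial σ ℝ,
      f = map (algebraMap ℝ ℂ) a + C Complex.I * map (algebraMap ℝ ℂ) b := by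
  induction f using MvPolynomial.induction_on with
  | C z =>
    refine ⟨C z.re, C z.im, ?_⟩
    rw [map_C, map_C, ← C_mul, ← C_add, mul_comm]
    exact congrArg C (Complex.re_add_im z).symm
  | add f g hf hg =>
    obtain ⟨a, b, rfl⟩ := hf
    obtain ⟨a', b', rfl⟩ := hg
    exact ⟨a + a', b + b', by simp only [map_add]; ring⟩
  | mul_X f n hf =>
    obtain ⟨a, b, rfl⟩ := hf
    exact ⟨a * X n, b * X n, by simp only [map_mul, map_X]; ring⟩

lemma coeff_map_add_I_mul_map_re {σ : Type*} (a b : MvPolynomial σ ℝ) (m : σ →₀ ℕ) :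
    (coeff m (map (algebraMap ℝ ℂ) a + C Complex.I * map (algebraMap ℝ ℂ) b)).re = coeff m a := by
  simp [coeff_map]

lemma eq_of_map_add_I_mul_map_eq {σ : Type*} {a b c : MvPolynomial σ ℝ}
    (h : map (algebraMap ℝ ℂ) a + C Complex.I * map (algebraMap ℝ ℂ) b =
      map (algebraMap ℝ ℂ) c) : a = c := by
  ext m
  rw [← coeff_map_add_I_mul_map_re a b, h, coeff_map]
  simp

lemma MvPolynomial.IsWeightedHomogeneous.re {σ M : Type*} [AddCommMonoid M] {w : σ → M} {d : M}
    {a b : MvPolynomial σ ℝ} (h : IsWeightedHomogeneous w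
      (map (algebraMap ℝ ℂ) a + C Complex.I * map (algebraMap ℝ ℂ) b) d) :
    IsWeightedHomogeneous w a d := by
  intro m hm
  refine h fun h0 => hm ?_
  rw [← coeff_map_add_I_mul_map_re a b, h0, Complex.zero_re]

/-- Real forms which are quadratic in two real forms over `ℂ` are so over `ℝ`. -/
lemma exists_real_quadratic {σ M : Type*} [AddCommMonoid M] {w : σ → M} {d : M}
    {p q G : MvPolynomial σ ℝ} {A B C : MvPolynomial σ ℂ}
    (hA : IsWeightedHomogeneous w A d) (hB : IsWeightedHomogeneous w B d)
    (hC : IsWeightedHomogeneous w C d)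
    (h : map (algebraMap ℝ ℂ) G = A * map (algebraMap ℝ ℂ) p ^ 2 +
      B * (map (algebraMap ℝ ℂ) p * map (algebraMap ℝ ℂ) q) + C * map (algebraMap ℝ ℂ) q ^ 2) :
    ∃ A B C : MvPolynomial σ ℝ, IsWeightedHomogeneous w A d ∧ IsWeightedHomogeneous w B d ∧
      IsWeightedHomogeneous w C d ∧ G = A * p ^ 2 + B * (p * q) + C * q ^ 2 := by
  obtain ⟨A, A', rfl⟩ := exists_map_add_I_mul_map A
  obtain ⟨B, B', rfl⟩ := exists_map_add_I_mul_map B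
  obtain ⟨C, C', rfl⟩ := exists_map_add_I_mul_map C
  refine ⟨A, B, C, hA.re, hB.re, hC.re, (eq_of_map_add_I_mul_map_eq
    (b := A' * p ^ 2 + B' * (p * q) + C' * q ^ 2) ?_).symm⟩
  rw [h]
  simp only [map_add, map_mul, map_pow]
  ring

/-- At a node, the quadratic form cutting the tangent directions is nondegenerate. -/
lemma not_degenerate_of_rank_hessian {K : Type*} [Field K] {σ : Type*} [Fintype σ]
    {p q A B C : MvPolynomial σ K} {z : σ → K} (hp : eval z p = 0) (hq : eval z q = 0)
    (hrank : (Matrix.of fun x y => eval z (pderiv x (pderiv y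
      (A * p ^ 2 + B * (p * q) + C * q ^ 2)))).rank = 2)
    {s t : K} (hst : ![s, t] ≠ 0)
    (h₁ : 2 * eval z A * s + eval z B * t = 0) : eval z B * s + 2 * eval z C * t ≠ 0 := by
  intro h₂
  set H : Matrix (Fin 2) (Fin 2) K :=
    !![2 * eval z A, eval z B; eval z B, 2 * eval z C]
  set J : Matrix σ (Fin 2) K :=
    Matrix.of fun x => ![eval z (pderiv x p), eval z (pderiv x q)]
  have hJ : (Matrix.of fun x y => eval z (pderiv x (pderiv y
      (A * p ^ 2 + B * (p * q) + C * q ^ 2)))) = J * H * J.transpose := by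
    ext x y
    simp only [Matrix.of_apply, Matrix.mul_apply, Fin.sum_univ_two, Matrix.transpose_apply, J, H,
      pow_two, map_add, map_mul, Derivation.leibniz, smul_eq_mul, hp, hq]
    simp
    ring
  have hdet : H.det = 0 := Matrix.exists_mulVec_eq_zero_iff.1 ⟨![s, t], hst, by
    funext i
    fin_cases i
    · simpa [H, Matrix.mulVec, dotProduct, Fin.sum_univ_two] using h₁
    · simpa [H, Matrix.mulVec, dotProduct, Fin.sum_univ_two] using h₂⟩
  have hH : 2 ≤ H.rank := by
    have h := (Matrix.rank_mul_le_left (J * H) J.transpose).trans (Matrix.rank_mul_le_right J H)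
    rwa [← hJ, hrank] at h
  have hsurj : Function.Surjective H.mulVecLin := by
    rw [← LinearMap.range_eq_top]
    refine Submodule.eq_top_of_finrank_eq (le_antisymm (Submodule.finrank_le _) ?_)
    simpa [Matrix.rank] using hH
  have hinj : Function.Injective H.mulVecLin := LinearMap.injective_iff_surjective.2 hsurj
  obtain ⟨x, hx, hx0⟩ := Matrix.exists_mulVec_eq_zero_iff.2 hdet
  exact hx (hinj (by simpa using hx0))

end DoublePoints

section ProjectiveCoordinates

open Topology

variable {ι : Type*}

/-- Homogeneous coordinates of a point of a product of projective lines. -/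
noncomputable def coords (x : ι → CP1) (p : ι × Fin 2) : ℂ := (x p.1).rep p.2

open Classical in
/-- The point of a product of projective lines with given homogeneous coordinates. -/
noncomputable def pointOfCoords (v : ι × Fin 2 → ℂ) (i : ι) : CP1 :=
  if h : (fun j => v (i, j)) ≠ 0 then .mk ℂ _ h else Classical.arbitrary _

lemma coords_ne_zero (x : ι → CP1) (i : ι) : (fun j => coords x (i, j)) ≠ 0 :=
  (x i).rep_nonzero

lemma pointOfCoords_apply {v : ι × Fin 2 → ℂ} {i : ι} (h : (fun j => v (i, j)) ≠ 0) :
    pointOfCoords v i = .mk ℂ _ h :=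
  dif_pos h

@[simp]
lemma pointOfCoords_coords (x : ι → CP1) : pointOfCoords (coords x) = x := by
  funext i
  rw [pointOfCoords_apply (coords_ne_zero x i)]
  exact (x i).mk_rep

lemma exists_coords_pointOfCoords {v : ι × Fin 2 → ℂ} (h : ∀ i, (fun j => v (i, j)) ≠ 0) :
    ∃ c : ι → ℂˣ, coords (pointOfCoords v) = fun p => (c p.1 : ℂ) * v p := by
  choose c hc using fun i => Projectivization.exists_smul_eq_mk_rep ℂ _ (h i)
  refine ⟨c, funext fun p => ?_⟩
  rw [coords, pointOfCoords_apply (h p.1), ← hc]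
  rfl

lemma pointOfCoords_eq_iff {v w : ι × Fin 2 → ℂ} (hv : ∀ i, (fun j => v (i, j)) ≠ 0)
    (hw : ∀ i, (fun j => w (i, j)) ≠ 0) :
    pointOfCoords v = pointOfCoords w ↔ ∀ i, v (i, 1) * w (i, 0) = v (i, 0) * w (i, 1) := by
  refine funext_iff.trans (forall_congr' fun i => ?_)
  rw [pointOfCoords_apply (hv i), pointOfCoords_apply (hw i), Projectivization.mk_eq_mk_iff']
  constructor
  · rintro ⟨a, ha⟩
    have h₀ := congrFun ha 0
    have h₁ := congrFun ha 1
    simp only [Pi.smul_apply, smul_eq_mul] at h₀ h₁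
    rw [← h₀, ← h₁]
    ring
  · intro h
    by_cases h0 : w (i, 0) = 0
    · have h1 : w (i, 1) ≠ 0 := fun h1 => hw i (funext fun j => by fin_cases j <;> simpa)
      refine ⟨v (i, 1) / w (i, 1), funext fun j => ?_⟩
      rw [h0, mul_zero, eq_comm, mul_eq_zero, or_iff_left h1] at h
      fin_cases j
      · simp [h0, h]
      · simp [h1]
    · refine ⟨v (i, 0) / w (i, 0), funext fun j => ?_⟩
      fin_cases j
      · simp [h0]
      · simp only [Fin.mk_one, Fin.isValue, Pi.smul_apply, smul_eq_mul]
        field_simp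
        rw [← h, mul_comm]

lemma eval_coords_pointOfCoords [Fintype ι] [DecidableEq ι] {f : MvPolynomial (ι × Fin 2) ℂ}
    {d : ι → ℕ} (hf : IsWeightedHomogeneous blockWeight f d) {v : ι × Fin 2 → ℂ}
    (h : ∀ i, (fun j => v (i, j)) ≠ 0) :
    eval (coords (pointOfCoords v)) f = 0 ↔ eval v f = 0 := by
  obtain ⟨c, hc⟩ := exists_coords_pointOfCoords h
  have := aeval_scale hf (fun i => (c i : ℂ)) v
  simp only [aeval_eq_eval] at this
  simp [hc, this, Finset.prod_eq_zero_iff]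

lemma isOpenQuotientMap_mk' :
    IsOpenQuotientMap (Projectivization.mk' ℂ : {v : Fin 2 → ℂ // v ≠ 0} → CP1) := by
  have hq : IsQuotientMap (Projectivization.mk' ℂ : {v : Fin 2 → ℂ // v ≠ 0} → CP1) :=
    isQuotientMap_quot_mk
  refine ⟨hq.surjective, hq.continuous, fun U hU => ?_⟩
  rw [← hq.isOpen_preimage]
  have : Projectivization.mk' ℂ ⁻¹' ((Projectivization.mk' ℂ : _ → CP1) '' U) =
      ⋃ c : ℂˣ, (fun v : {v : Fin 2 → ℂ // v ≠ 0} =>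
        (⟨c • (v : Fin 2 → ℂ), (smul_ne_zero_iff_ne c).2 v.2⟩ :
          {v : Fin 2 → ℂ // v ≠ 0})) ⁻¹' U := by
    ext v
    simp only [Set.mem_preimage, Set.mem_image, Set.mem_iUnion, Projectivization.mk'_eq_mk]
    constructor
    · rintro ⟨u, hu, huv⟩
      obtain ⟨c, hc⟩ := (Projectivization.mk_eq_mk_iff ℂ _ _ _ _).1 huv
      exact ⟨c, by simpa only [hc] using hu⟩
    · rintro ⟨c, hc⟩
      exact ⟨_, hc, (Projectivization.mk_eq_mk_iff ℂ _ _ _ _).2 ⟨c, rfl⟩⟩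
  rw [this]
  exact isOpen_iUnion fun c => hU.preimage (by fun_prop)

lemma continuousAt_pointOfCoords {v : ι × Fin 2 → ℂ} (h : ∀ i, (fun j => v (i, j)) ≠ 0) :
    ContinuousAt (pointOfCoords (ι := ι)) v := by
  refine continuousAt_pi.2 fun i => ?_
  have hg : ContinuousAt (fun w : Fin 2 → ℂ => pointOfCoords (fun p : Unit × Fin 2 => w p.2) ())
      (fun j => v (i, j)) := by
    have hU : IsOpen {w : Fin 2 → ℂ | w ≠ 0} := isOpen_ne
    refine (hU.isOpenEmbedding_subtypeVal.continuousAt_iff (x := ⟨_, h i⟩)).1 ?_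
    refine (isOpenQuotientMap_mk'.continuous.congr fun w => ?_).continuousAt
    exact (pointOfCoords_apply (v := fun p : Unit × Fin 2 => w.1 p.2) (i := ()) w.2).symm
  exact ContinuousAt.comp (f := fun (w : ι × Fin 2 → ℂ) j => w (i, j)) hg
    (continuous_pi fun j => continuous_apply (i, j)).continuousAt

lemma isClosed_setOf_eval_coords_eq_zero [Fintype ι] [DecidableEq ι]
    {f : MvPolynomial (ι × Fin 2) ℂ} {d : ι → ℕ} (hf : IsWeightedHomogeneous blockWeight f d) :
    IsClosed {x : ι → CP1 | eval (coords x) f = 0} := by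
  have hq := (IsOpenQuotientMap.piMap fun _ : ι => isOpenQuotientMap_mk').isQuotientMap
  rw [← hq.isClosed_preimage]
  convert isClosed_singleton.preimage (f := fun w : ι → {v : Fin 2 → ℂ // v ≠ 0} =>
    eval (fun p : ι × Fin 2 => (w p.1).1 p.2) f) (t := {0}) ?_ using 1
  · ext w
    have hw : ∀ i, (fun j => (w i).1 j) ≠ 0 := fun i => (w i).2
    rw [Set.mem_preimage, Set.mem_ofPred_eq, Set.mem_preimage, Set.mem_singleton_iff,
      ← eval_coords_pointOfCoords (v := fun p : ι × Fin 2 => (w p.1).1 p.2) hf hw]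
    congr!
    exact funext fun i =>
      (pointOfCoords_apply (v := fun p : ι × Fin 2 => (w p.1).1 p.2) (hw i)).symm
  · exact (continuous_eval f).comp (continuous_pi fun p =>
      (continuous_apply p.2).comp (continuous_subtype_val.comp (continuous_apply p.1)))

end ProjectiveCoordinates

section Transversality

open Topology Filter

variable {K : Type*} [RCLike K] {σ : Type*} [Fintype σ]

lemma MvPolynomial.hasStrictFDerivAt_eval (f : MvPolynomial σ K) (v : σ → K) :
    HasStrictFDerivAt (fun w => eval w f)
      (∑ x, eval v (pderiv x f) • ContinuousLinearMap.proj (R := K) (φ := fun _ : σ => K) x) v := by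
  classical
  induction f using MvPolynomial.induction_on with
  | C a =>
    simp only [eval_C]
    exact (hasStrictFDerivAt_const a v).congr_fderiv (by ext w; simp)
  | add f g hf hg =>
    simp only [map_add]
    refine (hf.fun_add hg).congr_fderiv ?_
    ext w
    simp [add_mul, Finset.sum_add_distrib]
  | mul_X f x hf =>
    simp only [map_mul, eval_X]
    have hx : HasStrictFDerivAt (fun w : σ → K => w x)
        (ContinuousLinearMap.proj (R := K) (φ := fun _ : σ => K) x) v :=
      (ContinuousLinearMap.proj (R := K) (φ := fun _ : σ => K) x).hasStrictFDerivAt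
    refine (hf.fun_mul hx).congr_fderiv ?_
    ext w
    simp [Derivation.leibniz, pderiv_X, add_mul, Finset.sum_add_distrib, Finset.mul_sum,
      Pi.single_apply, mul_assoc, apply_ite (eval v)]

/-- A tuple of polynomials with independent gradients is a submersion. -/
lemma MvPolynomial.map_nhds_eq {κ : Type*} [Fintype κ] (f : κ → MvPolynomial σ K) {v : σ → K}
    (h : LinearIndependent K fun i x => eval v (pderiv x (f i))) :
    Filter.map (fun w i => eval w (f i)) (𝓝 v) = 𝓝 fun i => eval v (f i) := by
  refine (hasStrictFDerivAt_pi.2 fun i => (f i).hasStrictFDerivAt_eval v).map_nhds_eq_of_surj ?_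
  set M : Matrix κ σ K := Matrix.of fun i x => eval v (pderiv x (f i))
  have hM : M.mulVecLin.range = ⊤ := Submodule.eq_top_of_finrank_eq <| by
    rw [Module.finrank_fintype_fun_eq_card]
    exact LinearIndependent.rank_matrix (M := M) h
  rw [LinearMap.range_eq_top] at hM ⊢
  convert hM using 1
  ext w i
  simp [M, Matrix.mulVec, dotProduct]

end Transversality

section StrictTransform

open Topology Filter

/-- The inclusion of the variables of the first two blocks. -/
def baseIndex (x : Fin 2 × Fin 2) : Fin 3 × Fin 2 := (x.1.castSucc, x.2)

lemma baseIndex_injective : Function.Injective baseIndex := by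
  rintro ⟨i, j⟩ ⟨i', j'⟩ h
  simpa [baseIndex] using h

/-- The form `v₃ q + u₃ p` cutting out the blow-up of the common zeros of `p` and `q`. -/
noncomputable def blowupForm {R : Type*} [CommRing R] (p q : MvPolynomial (Fin 2 × Fin 2) R) :
    MvPolynomial (Fin 3 × Fin 2) R :=
  rename baseIndex q * X (2, 1) + rename baseIndex p * X (2, 0)

/-- The quadratic form `A v₃² - B u₃v₃ + C u₃²` in the third block of variables. -/
noncomputable def quadraticForm {R : Type*} [CommRing R] (A B C : MvPolynomial (Fin 2 × Fin 2) R) :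
    MvPolynomial (Fin 3 × Fin 2) R :=
  rename baseIndex A * X (2, 1) ^ 2 - rename baseIndex B * (X (2, 0) * X (2, 1)) +
    rename baseIndex C * X (2, 0) ^ 2

lemma eval_blowupForm {R : Type*} [CommRing R] (p q : MvPolynomial (Fin 2 × Fin 2) R)
    (v : Fin 3 × Fin 2 → R) : eval v (blowupForm p q) =
      eval (v ∘ baseIndex) q * v (2, 1) + eval (v ∘ baseIndex) p * v (2, 0) := by
  simp [blowupForm, eval_rename]

lemma eval_quadraticForm {R : Type*} [CommRing R] (A B C : MvPolynomial (Fin 2 × Fin 2) R)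
    (v : Fin 3 × Fin 2 → R) : eval v (quadraticForm A B C) =
      eval (v ∘ baseIndex) A * v (2, 1) ^ 2 - eval (v ∘ baseIndex) B * (v (2, 0) * v (2, 1)) +
        eval (v ∘ baseIndex) C * v (2, 0) ^ 2 := by
  simp [quadraticForm, eval_rename]

lemma pderiv_rename_baseIndex {R : Type*} [CommRing R] (f : MvPolynomial (Fin 2 × Fin 2) R)
    (j : Fin 2) : pderiv (2, j) (rename baseIndex f) = 0 := by
  refine pderiv_eq_zero_of_notMem_vars fun h => ?_
  obtain ⟨⟨i, j'⟩, -, h⟩ := mem_vars_rename _ _ h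
  have h := congrArg Prod.fst h
  fin_cases i <;> simp [baseIndex, Fin.ext_iff] at h

/-- Near a point of the exceptional locus where the quadratic form is nondegenerate, the
intersection of the blow-up with the quadric contains points outside of the exceptional locus. -/
lemma frequently_nhds_eval_ne_zero {K : Type*} [RCLike K]
    {p q A B C : MvPolynomial (Fin 2 × Fin 2) K} {v : Fin 3 × Fin 2 → K}
    (hp : eval (v ∘ baseIndex) p = 0) (hq : eval (v ∘ baseIndex) q = 0)
    (hind : LinearIndependent K ![fun x => eval (v ∘ baseIndex) (pderiv x p),
      fun x => eval (v ∘ baseIndex) (pderiv x q)])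
    (hv : (fun j => v (2, j)) ≠ 0) (hQ : eval v (quadraticForm A B C) = 0)
    (hdeg : 2 * eval (v ∘ baseIndex) A * v (2, 1) - eval (v ∘ baseIndex) B * v (2, 0) = 0 →
      2 * eval (v ∘ baseIndex) C * v (2, 0) - eval (v ∘ baseIndex) B * v (2, 1) ≠ 0) :
    ∃ᶠ w in 𝓝 v, eval w (blowupForm p q) = 0 ∧ eval w (quadraticForm A B C) = 0 ∧
      ¬(eval (w ∘ baseIndex) p = 0 ∧ eval (w ∘ baseIndex) q = 0) := by
  obtain ⟨c, d, hcd⟩ : ∃ c d, v (2, 0) * d - v (2, 1) * c = 1 := by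
    by_cases h0 : v (2, 0) = 0
    · have h1 : v (2, 1) ≠ 0 := fun h1 => hv (funext fun j => by fin_cases j <;> simpa)
      exact ⟨-(v (2, 1))⁻¹, 0, by simp [h1]⟩
    · exact ⟨0, (v (2, 0))⁻¹, by simp [h0]⟩
  set f : Fin 3 → MvPolynomial (Fin 3 × Fin 2) K := ![blowupForm p q,
    rename baseIndex (MvPolynomial.C c * p + MvPolynomial.C d * q), quadraticForm A B C]
  have hf : LinearIndependent K fun i x => eval v (pderiv x (f i)) := by
    rw [Fintype.linearIndependent_iff]
    intro g hg
    simp only [Fin.sum_univ_three, f] at hg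
    have hg2 : g 2 = 0 := by
      by_contra hne
      have h0 := congrFun hg (2, 0)
      have h1 := congrFun hg (2, 1)
      simp [blowupForm, quadraticForm, pderiv_rename_baseIndex, Derivation.leibniz, pderiv_X,
        eval_rename, hp, hq, hne] at h0 h1
      exact hdeg (by linear_combination h1) (by linear_combination h0)
    have hbase := LinearIndependent.pair_iff.1 hind (g 0 * v (2, 0) + g 1 * c)
      (g 0 * v (2, 1) + g 1 * d) <| funext fun x => by
        have h := congrFun hg (baseIndex x)
        simp [hg2, blowupForm, Derivation.leibniz, eval_rename, hp, hq,
          pderiv_rename baseIndex_injective] at h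
        simp only [Pi.add_apply, Pi.smul_apply, smul_eq_mul, Pi.zero_apply]
        linear_combination h
    have hg0 : g 0 = 0 := by linear_combination d * hbase.1 - c * hbase.2 - g 0 * hcd
    have hg1 : g 1 = 0 := by
      linear_combination v (2, 0) * hbase.2 - v (2, 1) * hbase.1 - g 1 * hcd
    intro i
    fin_cases i
    exacts [hg0, hg1, hg2]
  have hmap := MvPolynomial.map_nhds_eq f hf
  have h0 : (fun i => eval v (f i)) = 0 := by
    funext i
    fin_cases i
    · simp [f, eval_blowupForm, hp, hq]
    · simp [f, eval_rename, hp, hq]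
    · exact hQ
  rw [h0] at hmap
  have hlim : Tendsto (fun ε : K => ![0, ε, 0]) (𝓝[≠] 0) (𝓝 0) := by
    have : Continuous fun ε : K => ![0, ε, 0] := by fun_prop
    convert this.continuousWithinAt.tendsto using 2
    ext i; fin_cases i <;> rfl
  have hfreq : ∃ᶠ y in 𝓝 (0 : Fin 3 → K), y 0 = 0 ∧ y 1 ≠ 0 ∧ y 2 = 0 :=
    hlim.frequently (Eventually.frequently <| by
      filter_upwards [self_mem_nhdsWithin] with ε hε using ⟨rfl, hε, rfl⟩)
  rw [← hmap, frequently_map] at hfreq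
  refine hfreq.mono fun w hw => ⟨hw.1, hw.2.2, fun h => hw.2.1 ?_⟩
  simp [f, eval_rename, h.1, h.2]

lemma eval_quadraticForm_eq_zero_iff {K : Type*} [Field K] {p q A B C : MvPolynomial _ K}
    {v : Fin 3 × Fin 2 → K} (hv : (fun j => v (2, j)) ≠ 0) (hF : eval v (blowupForm p q) = 0)
    (hpq : ¬(eval (v ∘ baseIndex) p = 0 ∧ eval (v ∘ baseIndex) q = 0)) :
    eval v (quadraticForm A B C) = 0 ↔
      eval (v ∘ baseIndex) (A * p ^ 2 + B * (p * q) + C * q ^ 2) = 0 := by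
  rw [eval_blowupForm] at hF
  rw [eval_quadraticForm]
  simp only [map_add, map_mul, map_pow]
  generalize eval (v ∘ baseIndex) p = p at *
  generalize eval (v ∘ baseIndex) q = q at *
  generalize eval (v ∘ baseIndex) A = A at *
  generalize eval (v ∘ baseIndex) B = B at *
  generalize eval (v ∘ baseIndex) C = C at *
  constructor
  · intro h
    by_cases h1 : v (2, 1) = 0
    · have h0 : v (2, 0) ≠ 0 := fun h0 => hv (funext fun j => by fin_cases j <;> simpa)
      refine (mul_eq_zero.1 (?_ : v (2, 0) ^ 2 * _ = 0)).resolve_left (pow_ne_zero 2 h0)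
      linear_combination q ^ 2 * h + (A * (v (2, 0) * p - q * v (2, 1)) + B * q * v (2, 0)) * hF
    · refine (mul_eq_zero.1 (?_ : v (2, 1) ^ 2 * _ = 0)).resolve_left (pow_ne_zero 2 h1)
      linear_combination p ^ 2 * h + (C * (v (2, 1) * q - p * v (2, 0)) + B * p * v (2, 1)) * hF
  · intro h
    by_cases h1 : p = 0
    · have h0 : q ≠ 0 := fun h0 => hpq ⟨h1, h0⟩
      refine (mul_eq_zero.1 (?_ : q ^ 2 * _ = 0)).resolve_left (pow_ne_zero 2 h0)
      linear_combination v (2, 0) ^ 2 * h -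
        (A * (v (2, 0) * p - q * v (2, 1)) + B * q * v (2, 0)) * hF
    · refine (mul_eq_zero.1 (?_ : p ^ 2 * _ = 0)).resolve_left (pow_ne_zero 2 h1)
      linear_combination v (2, 1) ^ 2 * h -
        (C * (v (2, 1) * q - p * v (2, 0)) + B * p * v (2, 1)) * hF

section Homogeneity

variable {K : Type*} [Field K]

lemma MvPolynomial.IsWeightedHomogeneous.rename_baseIndex {f : MvPolynomial (Fin 2 × Fin 2) K}
    {d : Fin 2 → ℕ} (hf : IsWeightedHomogeneous blockWeight f d) :
    IsWeightedHomogeneous blockWeight (rename baseIndex f) ![d 0, d 1, 0] := by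
  classical
  rw [isWeightedHomogeneous_blockWeight_iff] at hf ⊢
  intro m hm
  rw [support_rename_of_injective baseIndex_injective, Finset.mem_image] at hm
  obtain ⟨m, hm, rfl⟩ := hm
  have hb : ∀ x, m.mapDomain baseIndex (baseIndex x) = m x := fun x =>
    Finsupp.mapDomain_apply baseIndex_injective m x
  have h2 : ∀ j, m.mapDomain baseIndex (2, j) = 0 := fun j =>
    Finsupp.mapDomain_of_notMem_range m _ <| by
      rintro ⟨⟨i, j'⟩, h⟩
      have h := congrArg Prod.fst h
      fin_cases i <;> simp [baseIndex, Fin.ext_iff] at h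
  intro i
  fin_cases i
  · exact (congrArg₂ _ (hb (0, 0)) (hb (0, 1))).trans (hf m hm 0)
  · exact (congrArg₂ _ (hb (1, 0)) (hb (1, 1))).trans (hf m hm 1)
  · exact congrArg₂ _ (h2 0) (h2 1)

lemma blowupForm_isWeightedHomogeneous {p q : MvPolynomial (Fin 2 × Fin 2) K} {d : Fin 2 → ℕ}
    (hp : IsWeightedHomogeneous blockWeight p d) (hq : IsWeightedHomogeneous blockWeight q d) :
    IsWeightedHomogeneous blockWeight (blowupForm p q) ![d 0, d 1, 1] := by
  have hd : ∀ j : Fin 2, ![d 0, d 1, 0] + Pi.single (2, j).1 1 = ![d 0, d 1, 1] := fun j => by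
    ext i; fin_cases i <;> simp
  refine .add ?_ ?_
  · exact hd 1 ▸ hq.rename_baseIndex.mul (isWeightedHomogeneous_blockWeight_X _)
  · exact hd 0 ▸ hp.rename_baseIndex.mul (isWeightedHomogeneous_blockWeight_X _)

lemma quadraticForm_isWeightedHomogeneous {A B C : MvPolynomial (Fin 2 × Fin 2) K} {d : Fin 2 → ℕ}
    (hA : IsWeightedHomogeneous blockWeight A d) (hB : IsWeightedHomogeneous blockWeight B d)
    (hC : IsWeightedHomogeneous blockWeight C d) :
    IsWeightedHomogeneous blockWeight (quadraticForm A B C) ![d 0, d 1, 2] := by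
  have hd : ∀ i j : Fin 2, ![d 0, d 1, 0] + (Pi.single (2, i).1 1 + Pi.single (2, j).1 1) =
      ![d 0, d 1, 2] := fun i j => by
    ext i; fin_cases i <;> simp
  rw [quadraticForm, pow_two, pow_two]
  refine .add (.sub ?_ ?_) ?_
  · exact hd 1 1 ▸ hA.rename_baseIndex.mul
      ((isWeightedHomogeneous_blockWeight_X _).mul (isWeightedHomogeneous_blockWeight_X _))
  · exact hd 0 1 ▸ hB.rename_baseIndex.mul
      ((isWeightedHomogeneous_blockWeight_X _).mul (isWeightedHomogeneous_blockWeight_X _))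
  · exact hd 0 0 ▸ hC.rename_baseIndex.mul
      ((isWeightedHomogeneous_blockWeight_X _).mul (isWeightedHomogeneous_blockWeight_X _))

end Homogeneity

/-- The strict transform is the intersection of the blow-up with the quadric, when the curve has
only nodes at the centres of the blow-up. -/
lemma blowup_inter_quadric_eq_closure {p q A B C : MvPolynomial (Fin 2 × Fin 2) ℂ}
    {d d' d'' : Fin 2 → ℕ} (hp : IsWeightedHomogeneous blockWeight p d)
    (hq : IsWeightedHomogeneous blockWeight q d) (hA : IsWeightedHomogeneous blockWeight A d')
    (hB : IsWeightedHomogeneous blockWeight B d') (hC : IsWeightedHomogeneous blockWeight C d')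
    (hG : IsWeightedHomogeneous blockWeight (A * p ^ 2 + B * (p * q) + C * q ^ 2) d'')
    (hind : ∀ z, (∀ i, (fun j => z (i, j)) ≠ 0) → eval z p = 0 → eval z q = 0 →
      LinearIndependent ℂ ![fun x => eval z (pderiv x p), fun x => eval z (pderiv x q)])
    (hrank : ∀ z, (∀ i, (fun j => z (i, j)) ≠ 0) → eval z p = 0 → eval z q = 0 →
      (Matrix.of fun x y => eval z (pderiv x (pderiv y
        (A * p ^ 2 + B * (p * q) + C * q ^ 2)))).rank = 2) :
    {x : Fin 3 → CP1 | eval (coords x) (blowupForm p q) = 0} ∩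
        {x | eval (coords x) (quadraticForm A B C) = 0} =
      closure {x | eval (coords x) (blowupForm p q) = 0 ∧
        eval (coords x ∘ baseIndex) (A * p ^ 2 + B * (p * q) + C * q ^ 2) = 0 ∧
        ¬(eval (coords x ∘ baseIndex) p = 0 ∧ eval (coords x ∘ baseIndex) q = 0)} := by
  have hF := blowupForm_isWeightedHomogeneous hp hq
  have hQ := quadraticForm_isWeightedHomogeneous hA hB hC
  refine subset_antisymm (fun x hx => ?_) (closure_minimal (fun x hx => ⟨hx.1, ?_⟩) <|
    (isClosed_setOf_eval_coords_eq_zero hF).inter (isClosed_setOf_eval_coords_eq_zero hQ))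
  · by_cases hpq : eval (coords x ∘ baseIndex) p = 0 ∧ eval (coords x ∘ baseIndex) q = 0
    · have hbase : ∀ i, (fun j => (coords x ∘ baseIndex) (i, j)) ≠ 0 :=
        fun i => coords_ne_zero x i.castSucc
      have hfreq := frequently_nhds_eval_ne_zero (A := A) (B := B) (C := C) hpq.1 hpq.2
        (hind _ hbase hpq.1 hpq.2) (coords_ne_zero x 2) hx.2 fun h h' =>
        not_degenerate_of_rank_hessian hpq.1 hpq.2 (hrank _ hbase hpq.1 hpq.2)
          (s := coords x (2, 1)) (t := -coords x (2, 0))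
          (fun h0 => coords_ne_zero x 2 <| funext fun j => by
            have h1 := congrFun h0 0
            have h2 := congrFun h0 1
            fin_cases j
            · simpa using h2
            · simpa using h1)
          (by linear_combination h) (by linear_combination -h')
      have hne : ∀ᶠ w in 𝓝 (coords x), ∀ i, (fun j => w (i, j)) ≠ 0 :=
        eventually_all.2 fun i => ContinuousAt.eventually_ne
          (continuous_pi fun j => continuous_apply (i, j)).continuousAt (coords_ne_zero x i)
      have hlim : Tendsto pointOfCoords (𝓝 (coords x)) (𝓝 x) := by
        simpa only [ContinuousAt, pointOfCoords_coords] using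
          continuousAt_pointOfCoords (coords_ne_zero x)
      refine mem_closure_of_frequently_of_tendsto ((hfreq.and_eventually hne).mono ?_) hlim
      rintro w ⟨⟨hwF, hwQ, hwpq⟩, hw⟩
      have hwb : ∀ i, (fun j => (w ∘ baseIndex) (i, j)) ≠ 0 := fun i => hw i.castSucc
      have hcb : coords (pointOfCoords w) ∘ baseIndex = coords (pointOfCoords (w ∘ baseIndex)) :=
        rfl
      rw [Set.mem_ofPred_eq, hcb, eval_coords_pointOfCoords hF hw,
        eval_coords_pointOfCoords hG hwb, eval_coords_pointOfCoords hp hwb,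
        eval_coords_pointOfCoords hq hwb]
      exact ⟨hwF, (eval_quadraticForm_eq_zero_iff (hw 2) hwF hwpq).1 hwQ, hwpq⟩
    · exact subset_closure
        ⟨hx.1, (eval_quadraticForm_eq_zero_iff (coords_ne_zero x 2) hx.1 hpq).1 hx.2, hpq⟩
  · exact (eval_quadraticForm_eq_zero_iff (coords_ne_zero x 2) hx.1 hx.2.2).2 hx.2.1

end StrictTransform

section RealSurfaces

lemma isWeightedHomogeneous_blockWeight_iff_int {ι K : Type*} [DecidableEq ι] [Field K]
    {f : MvPolynomial (ι × Fin 2) K} {d : ι → ℕ} :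
    IsWeightedHomogeneous blockWeight f d ↔
      ∀ m ∈ f.support, ∀ i, (m (i, 0) : ℤ) + (m (i, 1) : ℤ) = d i := by
  rw [isWeightedHomogeneous_blockWeight_iff]
  norm_cast

lemma MvPolynomial.IsWeightedHomogeneous.map_algebraMap {σ M : Type*} [AddCommMonoid M] {w : σ → M}
    {f : MvPolynomial σ ℝ} {d : M} (hf : IsWeightedHomogeneous w f d) :
    IsWeightedHomogeneous w (map (algebraMap ℝ ℂ) f) d := fun m hm =>
  hf fun h => hm (by rw [coeff_map, h, map_zero])

lemma exists_representsCommonZeros {p q : MvPolynomial (Fin 2 × Fin 2) ℂ} {d : Fin 2 → ℕ}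
    (hp : IsWeightedHomogeneous blockWeight p d) (hq : IsWeightedHomogeneous blockWeight q d)
    (hfin : {x : Fin 2 → CP1 | eval (coords x) p = 0 ∧ eval (coords x) q = 0}.Finite) :
    ∃ Z, RepresentsCommonZeros p q Z ∧
      Z.card = {x : Fin 2 → CP1 | eval (coords x) p = 0 ∧ eval (coords x) q = 0}.ncard := by
  classical
  have hinj : Function.Injective (coords (ι := Fin 2)) :=
    Function.LeftInverse.injective pointOfCoords_coords
  refine ⟨hfin.toFinset.image coords, ⟨?_, ?_, ?_, ?_, ?_⟩, ?_⟩
  · simp only [Finset.forall_mem_image]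
    exact fun x _ => coords_ne_zero x
  · simp only [Finset.forall_mem_image, hfin.mem_toFinset]
    exact fun x hx => hx.1
  · simp only [Finset.forall_mem_image, hfin.mem_toFinset]
    exact fun x hx => hx.2
  · simp only [Finset.forall_mem_image]
    intro x _ y _ hne
    by_contra! h
    refine hne (congrArg coords ?_)
    rw [← pointOfCoords_coords x, ← pointOfCoords_coords y, eq_comm,
      pointOfCoords_eq_iff (coords_ne_zero y) (coords_ne_zero x)]
    exact h
  · intro v hv hvp hvq
    refine ⟨coords (pointOfCoords v), Finset.mem_image_of_mem _ (hfin.mem_toFinset.2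
      ⟨(eval_coords_pointOfCoords hp hv).2 hvp, (eval_coords_pointOfCoords hq hv).2 hvq⟩), ?_⟩
    rw [← pointOfCoords_eq_iff (coords_ne_zero _) hv, pointOfCoords_coords]
  · rw [Finset.card_image_of_injective _ hinj, Set.ncard_eq_toFinset_card _ hfin]

lemma map_blowupForm {R S : Type*} [CommRing R] [CommRing S] (φ : R →+* S)
    (p q : MvPolynomial (Fin 2 × Fin 2) R) :
    map φ (blowupForm p q) = blowupForm (map φ p) (map φ q) := by
  simp [blowupForm, map_rename]

lemma map_quadraticForm {R S : Type*} [CommRing R] [CommRing S] (φ : R →+* S)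
    (A B C : MvPolynomial (Fin 2 × Fin 2) R) :
    map φ (quadraticForm A B C) = quadraticForm (map φ A) (map φ B) (map φ C) := by
  simp [quadraticForm, map_rename]

end RealSurfaces

/-- Given two nonsingular curves `{P₀=0}`, `{P₁=0}` of bidegree `(k,l)`
meeting transversely in `2kl` points and an irreducible curve `D` of bidegree `(4k,4l)`
with `2kl` ordinary double points, one at each intersection point, there is a surface
`{Q=0}` of tridegree `(2k,2l,2)` such that the strict transform of `D` in the blow-up
`{P=0}` (`P = v₃P₁ + u₃P₀`) is `{P=0} ∩ {Q=0}`. -/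
theorem exists_Q_cutting_strict_transform
    (k l : ℕ) (hk : 1 ≤ k) (hl : 1 ≤ l)
    (P0 P1 D : BiPoly)
    (hP0 : IsBiHomogeneous P0 ![k, l]) (hP1 : IsBiHomogeneous P1 ![k, l])
    (hns0 : IsNonsingularCurve P0) (hns1 : IsNonsingularCurve P1)
    (htrans : MeetTransversally P0 P1)
    (hcard : Nat.card ↥(CurveComplexLocus P0 ∩ CurveComplexLocus P1) = 2 * k * l)
    (hD : IsBiHomogeneous D ![4 * k, 4 * l])
    (hirr : Irreducible (D.map (algebraMap ℝ ℂ)))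
    -- `D` has an ordinary double point at each intersection point of `{P₀=0}` and `{P₁=0}`:
    (hnodes : ∀ v : Fin 2 × Fin 2 → ℂ, (∀ i : Fin 2, (fun j => v (i, j)) ≠ 0) →
      eval v (P0.map (algebraMap ℝ ℂ)) = 0 → eval v (P1.map (algebraMap ℝ ℂ)) = 0 →
      IsNodeCone D v)
    -- and no other singular points:
    (honly : ∀ v : Fin 2 × Fin 2 → ℂ, (∀ i : Fin 2, (fun j => v (i, j)) ≠ 0) →
      eval v (D.map (algebraMap ℝ ℂ)) = 0 →
      (∀ p, eval v ((pderiv p D).map (algebraMap ℝ ℂ)) = 0) →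
      eval v (P0.map (algebraMap ℝ ℂ)) = 0 ∧ eval v (P1.map (algebraMap ℝ ℂ)) = 0)
    -- the blow-up `{P = 0}` of `(ℂP¹)²`, `P = v₃P₁ + u₃P₀`:
    (F : TriPoly)
    (hF : F = rename (fun p : Fin 2 × Fin 2 => ((p.1.castSucc : Fin 3), p.2)) P1 *
                X ((2 : Fin 3), (1 : Fin 2)) +
              rename (fun p : Fin 2 × Fin 2 => ((p.1.castSucc : Fin 3), p.2)) P0 *
                X ((2 : Fin 3), (0 : Fin 2))) :
    ∃ Q : TriPoly, IsTriHomogeneous Q ![2 * k, 2 * l, 2] ∧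
      ComplexLocus F ∩ ComplexLocus Q =
        closure {x : Fin 3 → CP1 | x ∈ ComplexLocus F ∧
          (fun i : Fin 2 => x i.castSucc) ∈
            CurveComplexLocus D \ (CurveComplexLocus P0 ∩ CurveComplexLocus P1)} := by

  have hP0' : IsWeightedHomogeneous blockWeight P0 ![k, l] :=
    isWeightedHomogeneous_blockWeight_iff_int.2 fun m hm i => by
      rw [hP0 m hm i]; fin_cases i <;> rfl
  have hP1' : IsWeightedHomogeneous blockWeight P1 ![k, l] :=
    isWeightedHomogeneous_blockWeight_iff_int.2 fun m hm i => by
      rw [hP1 m hm i]; fin_cases i <;> rfl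
  have hD' : IsWeightedHomogeneous blockWeight D (![k, l] + ![k, l] + ![k, l] + ![k, l]) :=
    isWeightedHomogeneous_blockWeight_iff_int.2 fun m hm i => by
      rw [hD m hm i]; fin_cases i <;> simp <;> ring
  have hset : CurveComplexLocus P0 ∩ CurveComplexLocus P1 = {x : Fin 2 → CP1 |
      eval (coords x) (P0.map (algebraMap ℝ ℂ)) = 0 ∧
        eval (coords x) (P1.map (algebraMap ℝ ℂ)) = 0} := rfl
  rw [Nat.card_coe_set_eq, hset] at hcard
  have hpos : 0 < 2 * k * l := by positivity
  obtain ⟨Z, hZ, hZcard⟩ := exists_representsCommonZeros hP0'.map_algebraMap hP1'.map_algebraMap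
    (Set.finite_of_ncard_pos (hcard ▸ hpos))
  rw [hcard] at hZcard
  have hind : ∀ z : Fin 2 × Fin 2 → ℂ, (∀ i, (fun j => z (i, j)) ≠ 0) →
      eval z (P0.map (algebraMap ℝ ℂ)) = 0 → eval z (P1.map (algebraMap ℝ ℂ)) = 0 →
      LinearIndependent ℂ ![fun x => eval z (pderiv x (P0.map (algebraMap ℝ ℂ))),
        fun x => eval z (pderiv x (P1.map (algebraMap ℝ ℂ)))] := by
    simp only [pderiv_map]
    exact htrans
  have hq0 : P1.map (algebraMap ℝ ℂ) ≠ 0 := by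
    obtain ⟨z, hz⟩ := Finset.card_pos.1 (hZcard ▸ hpos)
    intro h
    have := (hind z (hZ.ne_zero z hz) (hZ.eval_fst z hz) (hZ.eval_snd z hz)).ne_zero 1
    refine this (funext fun x => ?_)
    simp [h]
  have hnode := fun z hz => hnodes z (hZ.ne_zero z hz) (hZ.eval_fst z hz) (hZ.eval_snd z hz)
  obtain ⟨A, B, C, hA, hB, hC, hABC⟩ := hZ.exists_eq_quadratic hP0'.map_algebraMap
    hP1'.map_algebraMap hq0 hZcard
    (fun z hz => hind z (hZ.ne_zero z hz) (hZ.eval_fst z hz) (hZ.eval_snd z hz))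
    hD'.map_algebraMap (fun z hz => (hnode z hz).2.1)
    (fun z hz x => by rw [pderiv_map]; exact (hnode z hz).2.2.1 x)
  obtain ⟨A, B, C, hA, hB, hC, rfl⟩ := exists_real_quadratic hA hB hC hABC
  have hDmap : map (algebraMap ℝ ℂ) (A * P0 ^ 2 + B * (P0 * P1) + C * P1 ^ 2) =
      map (algebraMap ℝ ℂ) A * map (algebraMap ℝ ℂ) P0 ^ 2 +
        map (algebraMap ℝ ℂ) B * (map (algebraMap ℝ ℂ) P0 * map (algebraMap ℝ ℂ) P1) +
        map (algebraMap ℝ ℂ) C * map (algebraMap ℝ ℂ) P1 ^ 2 := by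
    simp only [map_add, map_mul, map_pow]
  have hFP : F = blowupForm P0 P1 := hF
  refine ⟨quadraticForm A B C, fun m hm i => ?_, ?_⟩
  · rw [isWeightedHomogeneous_blockWeight_iff_int.1 (quadraticForm_isWeightedHomogeneous hA hB hC)
      m hm i]
    fin_cases i <;> simp <;> ring
  · have := blowup_inter_quadric_eq_closure hP0'.map_algebraMap hP1'.map_algebraMap
      hA.map_algebraMap hB.map_algebraMap hC.map_algebraMap (hDmap ▸ hD'.map_algebraMap) hind
      fun z hz hz0 hz1 => by
        rw [← hDmap]
        simpa only [pderiv_map] using (hnodes z hz hz0 hz1).2.2.2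
    rw [← hDmap, ← map_blowupForm, ← map_quadraticForm, ← hFP] at this
    exact this
end

section
/- Let P be a real polynomial of bidegree (4k,4) defining an irreducible curve in (CP^1)^2 whose only singularities are 2k nondegenerate double points in (C*)^2. Then P can be perturbed (within any neighborhood of P in the space of polynomials of bidegree (4k,4), preserving the number and type of the double points) so that the 2k double points of the perturbed curve are in general position in ((C*)^2)^{2k}; more precisely, if I denotes the incidence variety of pairs consisting of a nearby polynomial with 2k nearby double points together with those double points, then the image of I under the projection to the configuration space ((C*)^2)^{2k} has dimension 4k. -/
open MvPolynomial

/-- The coefficient space of polynomials with monomials in the finite lattice set `L`: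
this is the space `P(Δ)` of polynomials with Newton polytope (contained in) `Δ`,
coordinatized by coefficients. -/
abbrev Coef (L : Finset (ℕ × ℕ)) : Type := {p : ℕ × ℕ // p ∈ L} → ℂ

/-- The polynomial with coefficient vector `c`. -/
noncomputable def toPoly {L : Finset (ℕ × ℕ)} (c : Coef L) : MvPolynomial (Fin 2) ℂ :=
  ∑ p : {p : ℕ × ℕ // p ∈ L},
    monomial (Finsupp.single 0 p.1.1 + Finsupp.single 1 p.1.2) (c p)

/-- `z ∈ (ℂ*)²` is a singular point of the curve `{f = 0}`. -/
def IsSingAt (f : MvPolynomial (Fin 2) ℂ) (z : Fin 2 → ℂ) : Prop :=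
  z 0 ≠ 0 ∧ z 1 ≠ 0 ∧ eval z f = 0 ∧
    eval z (pderiv 0 f) = 0 ∧ eval z (pderiv 1 f) = 0

/-- `z ∈ (ℂ*)²` is a nondegenerate double point (ordinary quadratic point, node)
of the curve `{f = 0}`. -/
def IsNodeAt (f : MvPolynomial (Fin 2) ℂ) (z : Fin 2 → ℂ) : Prop :=
  IsSingAt f z ∧
    eval z (pderiv 0 (pderiv 0 f)) * eval z (pderiv 1 (pderiv 1 f)) -
      eval z (pderiv 0 (pderiv 1 f)) * eval z (pderiv 1 (pderiv 0 f)) ≠ 0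

def toR (p : ℕ × ℕ) : ℝ × ℝ := ((p.1 : ℝ), (p.2 : ℝ))

/-- The convex hull of the lattice set `L`. -/
def hullOf (L : Finset (ℕ × ℕ)) : Set (ℝ × ℝ) := convexHull ℝ (toR '' L)

/-- `L` is exactly the set of lattice points of the integer convex polytope `conv L`. -/
def IsLatticePolytopeSet (L : Finset (ℕ × ℕ)) : Prop :=
  ∀ p : ℕ × ℕ, toR p ∈ hullOf L ↔ p ∈ L

/-- `b(Δ)`: the number of lattice points on the boundary of the polytope. -/
noncomputable def boundaryLatticeCount (L : Finset (ℕ × ℕ)) : ℕ :=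
  Set.ncard {p : ℕ × ℕ | toR p ∈ frontier (hullOf L)}


/-- The lattice points of the rectangle `[0,a] × [0,b]` (the Newton polytope of
polynomials of bidegree `(a,b)`). -/
def rectangle (a b : ℕ) : Finset (ℕ × ℕ) := Finset.range (a + 1) ×ˢ Finset.range (b + 1)

section LinearStructure

variable {L : Finset (ℕ × ℕ)}

/-- `toPoly` as a linear map. -/
noncomputable def toPolyLin (L : Finset (ℕ × ℕ)) : Coef L →ₗ[ℂ] MvPolynomial (Fin 2) ℂ where
  toFun := toPoly
  map_add' c d := by simp [toPoly, Finset.sum_add_distrib]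
  map_smul' r c := by simp [toPoly, Finset.smul_sum, smul_monomial]

lemma toPolyLin_apply (c : Coef L) : toPolyLin L c = toPoly c := rfl

lemma toPoly_eq_sum_smul (c : Coef L) :
    toPoly c = ∑ p : {p : ℕ × ℕ // p ∈ L},
      c p • monomial (Finsupp.single 0 p.1.1 + Finsupp.single 1 p.1.2) (1 : ℂ) := by
  simp [toPoly, smul_monomial]

lemma toPoly_add_sum_smul {κ : Type*} [Fintype κ] (c : Coef L) (p : κ → ℂ) (B : κ → Coef L) :
    toPoly (c + ∑ x, p x • B x) = toPoly c + ∑ x, p x • toPoly (B x) := by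
  simp only [← toPolyLin_apply, map_add, map_sum, map_smul]

lemma coeff_toPoly (c : Coef L) (m : Fin 2 →₀ ℕ) :
    coeff m (toPoly c) = if h : (m 0, m 1) ∈ L then c ⟨(m 0, m 1), h⟩ else 0 := by
  have key : ∀ p : ℕ × ℕ,
      (Finsupp.single 0 p.1 + Finsupp.single 1 p.2 : Fin 2 →₀ ℕ) = m ↔ p = (m 0, m 1) := by
    intro p
    rw [Finsupp.ext_iff, Fin.forall_fin_two, Prod.ext_iff]
    simp
  simp only [toPoly, coeff_sum, coeff_monomial, key]
  split_ifs with h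
  · rw [Finset.sum_eq_single ⟨(m 0, m 1), h⟩] <;> simp +contextual [Subtype.ext_iff]
  · refine Finset.sum_eq_zero fun p _ => if_neg ?_
    intro hp
    exact h (hp ▸ p.2)

lemma exists_toPoly_eq {a b : ℕ} {f : MvPolynomial (Fin 2) ℂ} (h0 : degreeOf 0 f ≤ a)
    (h1 : degreeOf 1 f ≤ b) : ∃ c : Coef (rectangle a b), toPoly c = f := by
  refine ⟨fun p => coeff (Finsupp.single 0 p.1.1 + Finsupp.single 1 p.1.2) f, ?_⟩
  ext m
  rw [coeff_toPoly]
  split_ifs with h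
  · congr 1
    rw [Finsupp.ext_iff, Fin.forall_fin_two]
    simp
  · by_contra hm
    have hm' := mem_support_iff.2 (Ne.symm hm)
    have e0 := (monomial_le_degreeOf 0 hm').trans h0
    have e1 := (monomial_le_degreeOf 1 hm').trans h1
    exact h (by simp [rectangle]; omega)

end LinearStructure

section Jets

/-- The identity and the two partial derivatives. -/
noncomputable def jetOp : Fin 3 → MvPolynomial (Fin 2) ℂ →ₗ[ℂ] MvPolynomial (Fin 2) ℂ :=
  ![LinearMap.id, (pderiv 0 : Derivation ℂ _ _).toLinearMap,
    (pderiv 1 : Derivation ℂ _ _).toLinearMap]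

/-- The monomials `1`, `x`, `y`. -/
noncomputable def affineMonomial : Fin 3 → MvPolynomial (Fin 2) ℂ := ![1, X 0, X 1]

/-- The affine polynomial `c₀ + c₁ x + c₂ y`. -/
noncomputable def affinePoly (c : Fin 3 → ℂ) : MvPolynomial (Fin 2) ℂ :=
  ∑ m, c m • affineMonomial m

lemma jetOp_eq_zero_iff (f : MvPolynomial (Fin 2) ℂ) (w : Fin 2 → ℂ) :
    (∀ m, eval w (jetOp m f) = 0) ↔
      eval w f = 0 ∧ eval w (pderiv 0 f) = 0 ∧ eval w (pderiv 1 f) = 0 := by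
  simp [Fin.forall_fin_succ, jetOp]

lemma eval_jetOp_sq_mul {a b : MvPolynomial (Fin 2) ℂ} {w : Fin 2 → ℂ} (ha : eval w a = 0)
    (m : Fin 3) : eval w (jetOp m (a ^ 2 * b)) = 0 := by
  revert m
  rw [jetOp_eq_zero_iff]
  simp [ha, Derivation.leibniz, Derivation.leibniz_pow]

lemma continuous_eval_toPoly {L : Finset (ℕ × ℕ)}
    (D : MvPolynomial (Fin 2) ℂ →ₗ[ℂ] MvPolynomial (Fin 2) ℂ) :
    Continuous fun x : (Fin 2 → ℂ) × Coef L => eval x.1 (D (toPoly x.2)) := by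
  simp only [toPoly_eq_sum_smul, map_sum, map_smul, smul_eval]
  refine continuous_finsetSum _ fun p _ => ?_
  exact ((continuous_apply p).comp continuous_snd).mul
    ((MvPolynomial.continuous_eval _).comp continuous_fst)

lemma contDiff_eval (f : MvPolynomial (Fin 2) ℂ) :
    ContDiff ℂ 1 fun w : Fin 2 → ℂ => eval w f := by
  induction f using MvPolynomial.induction_on with
  | C a => simpa using contDiff_const
  | add p q hp hq => simpa using hp.add hq
  | mul_X p i hp => simpa using hp.mul (contDiff_apply ℂ ℂ i)

/-- The coefficients of the affine polynomial `A` for which `H + A F` is singular at `w`, in terms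
of the jets of `H` and `F` at `w`. -/
noncomputable def solveAffine (w : Fin 2 → ℂ) (h f : Fin 3 → ℂ) : Fin 3 → ℂ :=
  let g := -h 0 / f 0
  let b := -(h 1 + g * f 1) / f 0
  let c := -(h 2 + g * f 2) / f 0
  ![g - b * w 0 - c * w 1, b, c]

lemma eq_solveAffine {H F : MvPolynomial (Fin 2) ℂ} {w : Fin 2 → ℂ} {c : Fin 3 → ℂ}
    (hF : eval w F ≠ 0) (h : ∀ m, eval w (jetOp m (H + affinePoly c * F)) = 0) :
    c = solveAffine w (fun m => eval w (jetOp m H)) (fun m => eval w (jetOp m F)) := by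
  rw [jetOp_eq_zero_iff] at h
  obtain ⟨h0, h1, h2⟩ := h
  simp [affinePoly, Fin.sum_univ_three, affineMonomial, Derivation.leibniz, smul_eval] at h0 h1 h2
  have e0 : c 0 + c 1 * w 0 + c 2 * w 1 = - eval w H / eval w F := by
    field_simp; linear_combination h0
  have e1 : c 1 = -(eval w (pderiv 0 H) + (- eval w H / eval w F) * eval w (pderiv 0 F)) /
      eval w F := by
    rw [← e0]; field_simp; linear_combination h1
  have e2 : c 2 = -(eval w (pderiv 1 H) + (- eval w H / eval w F) * eval w (pderiv 1 F)) /
      eval w F := by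
    rw [← e0]; field_simp; linear_combination h2
  ext m
  fin_cases m
  · simp [solveAffine, jetOp]
    linear_combination e0 - w 0 * e1 - w 1 * e2
  · simpa [solveAffine, jetOp] using e1
  · simpa [solveAffine, jetOp] using e2

end Jets
section Bertini

open Topology Module

lemma contDiff_eval_jetOp_add_sum {n : ℕ} (m : Fin 3) (H : MvPolynomial (Fin 2) ℂ)
    (F : Fin n → MvPolynomial (Fin 2) ℂ) :
    ContDiff ℂ 1 fun x : (Fin 2 → ℂ) × (Fin n → Fin 3 → ℂ) =>
      eval x.1 (jetOp m (H + ∑ j, affinePoly (x.2 j) * F j)) := by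
  simp only [affinePoly, Finset.sum_mul, smul_mul_assoc, map_add, map_sum, map_smul, smul_eval]
  refine ((contDiff_eval _).comp contDiff_fst).add
    (ContDiff.sum fun j _ => ContDiff.sum fun l _ => ContDiff.mul ?_ ?_)
  · exact (contDiff_apply ℂ ℂ l).comp ((contDiff_apply ℂ (Fin 3 → ℂ) j).comp contDiff_snd)
  · exact (contDiff_eval _).comp contDiff_fst

lemma contDiffAt_solveAffine {E : Type*} [NormedAddCommGroup E] [NormedSpace ℂ E] {x : E}
    {w : E → Fin 2 → ℂ} {h f : E → Fin 3 → ℂ} (hw : ContDiffAt ℂ 1 w x)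
    (hh : ContDiffAt ℂ 1 h x) (hf : ContDiffAt ℂ 1 f x) (hx : f x 0 ≠ 0) :
    ContDiffAt ℂ 1 (fun x => solveAffine (w x) (h x) (f x)) x := by
  rw [contDiffAt_pi] at hw hh hf
  have hg := (hh 0).neg.div (hf 0) hx
  have hb := ((hh 1).add (hg.mul (hf 1))).neg.div (hf 0) hx
  have hc := ((hh 2).add (hg.mul (hf 2))).neg.div (hf 0) hx
  rw [contDiffAt_pi]
  intro m
  fin_cases m
  · exact (hg.sub (hb.mul (hw 0))).sub (hc.mul (hw 1))
  · exact hb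
  · exact hc

lemma dimH_singular_le {n : ℕ} (H : MvPolynomial (Fin 2) ℂ)
    (F : Fin (n + 1) → MvPolynomial (Fin 2) ℂ) (i : Fin (n + 1)) :
    dimH {p : Fin (n + 1) → Fin 3 → ℂ | ∃ w, eval w (F i) ≠ 0 ∧
      ∀ m, eval w (jetOp m (H + ∑ j, affinePoly (p j) * F j)) = 0} ≤
      finrank ℝ ((Fin 2 → ℂ) × (Fin n → Fin 3 → ℂ)) := by
  let Φ : (Fin 2 → ℂ) × (Fin n → Fin 3 → ℂ) → Fin (n + 1) → Fin 3 → ℂ := fun x =>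
    i.insertNth (solveAffine x.1
      (fun m => eval x.1 (jetOp m (H + ∑ j, affinePoly (x.2 j) * F (i.succAbove j))))
      (fun m => eval x.1 (jetOp m (F i)))) x.2
  let s : Set ((Fin 2 → ℂ) × (Fin n → Fin 3 → ℂ)) := {x | eval x.1 (F i) ≠ 0}
  calc _ ≤ dimH (Φ '' s) := dimH_mono ?_
    _ ≤ dimH s := dimH_image_le_of_locally_lipschitzOn fun x hx => ?_
    _ ≤ dimH Set.univ := dimH_mono (Set.subset_univ _)
    _ = _ := Real.dimH_univ_eq_finrank _
  · rintro p ⟨w, hw, h⟩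
    refine ⟨(w, fun j => p (i.succAbove j)), hw, ?_⟩
    have key := eq_solveAffine (H := H + ∑ j, affinePoly (p (i.succAbove j)) * F (i.succAbove j))
      (c := p i) hw (by
        rw [Fin.sum_univ_succAbove _ i] at h
        convert h using 4
        ring)
    rw [Fin.insertNth_eq_iff]
    exact ⟨key.symm, rfl⟩
  · have hΦ : ContDiffAt ℂ 1 Φ x := by
      rw [contDiffAt_pi, Fin.forall_iff_succAbove i]
      constructor
      · simp only [Φ, Fin.insertNth_apply_same]
        refine contDiffAt_solveAffine contDiffAt_fst ?_ ?_ (by simpa [jetOp, s] using hx)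
        · exact contDiffAt_pi.2 fun m => (contDiff_eval_jetOp_add_sum m H _).contDiffAt
        · exact contDiffAt_pi.2 fun m => ((contDiff_eval _).comp contDiff_fst).contDiffAt
      · intro j
        simp only [Φ, Fin.insertNth_apply_succAbove]
        exact ((contDiff_apply ℂ (Fin 3 → ℂ) j).comp contDiff_snd).contDiffAt
    obtain ⟨K, t, ht, hK⟩ := hΦ.exists_lipschitzOnWith
    exact ⟨K, t, mem_nhdsWithin_of_mem_nhds ht, hK⟩

/-- A Bertini-type statement: a generic member of the linear system spanned by `H` and the affine
multiples of the `F j` is nonsingular away from the common zeros of the `F j`. -/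
lemma dense_nonsingular {n : ℕ} (H : MvPolynomial (Fin 2) ℂ)
    (F : Fin n → MvPolynomial (Fin 2) ℂ) :
    Dense {p : Fin n → Fin 3 → ℂ | ∀ w, (∃ i, eval w (F i) ≠ 0) →
      ¬ ∀ m, eval w (jetOp m (H + ∑ j, affinePoly (p j) * F j)) = 0} := by
  cases n with
  | zero => simp
  | succ n =>
    have key := dense_compl_of_dimH_lt_finrank (E := Fin (n + 1) → Fin 3 → ℂ)
      (s := ⋃ i, {p | ∃ w, eval w (F i) ≠ 0 ∧
        ∀ m, eval w (jetOp m (H + ∑ j, affinePoly (p j) * F j)) = 0}) (by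
      rw [dimH_iUnion]
      refine (iSup_le fun i => dimH_singular_le H F i).trans_lt ?_
      have e1 : finrank ℝ ((Fin 2 → ℂ) × (Fin n → Fin 3 → ℂ)) = 4 + n * 6 := by
        simp [Module.finrank_pi_fintype]
      have e2 : finrank ℝ (Fin (n + 1) → Fin 3 → ℂ) = (n + 1) * 6 := by
        simp [Module.finrank_pi_fintype]
      rw [e1, e2]
      exact_mod_cast (by omega))
    refine key.mono fun p hp w => ?_
    rintro ⟨i, hi⟩ h
    exact hp (Set.mem_iUnion.2 ⟨i, w, hi, h⟩)

end Bertini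
section Deformation

open Topology Matrix

/-- If the `F j` separate the jets at the points `z₀ i`, a polynomial singular at the `z₀ i` deforms
continuously along any deformation of these points. -/
lemma exists_continuous_deformation {ι : Type*} [Fintype ι] [DecidableEq ι]
    {L : Finset (ℕ × ℕ)} (P : Coef L) (z₀ : ι → Fin 2 → ℂ)
    (hP : ∀ i m, eval (z₀ i) (jetOp m (toPoly P)) = 0) (F : ι → MvPolynomial (Fin 2) ℂ)
    (hF : ∀ i, eval (z₀ i) (F i) ≠ 0)
    (hF' : ∀ i j, j ≠ i → ∃ a b, F j = a ^ 2 * b ∧ eval (z₀ i) a = 0)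
    (hL : ∀ i m, ∃ c : Coef L, toPoly c = affineMonomial m * F i) :
    ∃ q : (ι → Fin 2 → ℂ) → Coef L, ContinuousAt q z₀ ∧ q z₀ = P ∧
      ∀ᶠ z in 𝓝 z₀, ∀ i m, eval (z i) (jetOp m (toPoly (q z))) = 0 := by
  choose B hB using hL
  let A : (ι → Fin 2 → ℂ) → Matrix (ι × Fin 3) (ι × Fin 3) ℂ := fun z =>
    Matrix.of fun r x => eval (z r.1) (jetOp r.2 (toPoly (B x.1 x.2)))
  let J : (ι → Fin 2 → ℂ) → ι × Fin 3 → ℂ := fun z r => eval (z r.1) (jetOp r.2 (toPoly P))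
  have hcont : ∀ (m : Fin 3) (i : ι) (c : Coef L),
      Continuous fun z : ι → Fin 2 → ℂ => eval (z i) (jetOp m (toPoly c)) := fun m i c =>
    (MvPolynomial.continuous_eval _).comp (continuous_apply i)
  have hA : Continuous A := continuous_matrix fun r x => hcont _ _ _
  have hJ : Continuous J := continuous_pi fun r => hcont _ _ _
  have hdet : (A z₀).det ≠ 0 := by
    intro h
    obtain ⟨v, hv, hv'⟩ := Matrix.exists_mulVec_eq_zero_iff.2 h
    refine hv ?_
    have hzero : ∀ i, (fun m => v (i, m)) = 0 := by
      intro i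
      have key := eq_solveAffine (H := 0) (c := fun m => v (i, m)) (hF i) (by
        intro m
        have h1 := congrFun hv' (i, m)
        simp only [A, Matrix.mulVec, dotProduct, Matrix.of_apply, Fintype.sum_prod_type,
          Pi.zero_apply, hB] at h1
        rw [Finset.sum_eq_single i] at h1
        · rw [← h1, zero_add, affinePoly, Finset.sum_mul]
          simp only [smul_mul_assoc, map_sum, map_smul, smul_eval]
          exact Finset.sum_congr rfl fun _ _ => mul_comm _ _
        · intro j _ hji
          obtain ⟨a, b, hab, ha⟩ := hF' i j hji
          refine Finset.sum_eq_zero fun l _ => ?_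
          rw [hab, mul_left_comm, eval_jetOp_sq_mul ha, zero_mul]
        · simp)
      rw [key]
      ext m
      fin_cases m <;> simp [solveAffine]
    ext ⟨i, m⟩
    exact congrFun (hzero i) m
  let p : (ι → Fin 2 → ℂ) → ι × Fin 3 → ℂ := fun z => -((A z)⁻¹ *ᵥ J z)
  have hJ0 : J z₀ = 0 := funext fun r => hP r.1 r.2
  have hp0 : p z₀ = 0 := by simp [p, hJ0]
  have hinv : ContinuousAt (fun z => (A z)⁻¹) z₀ :=
    (continuousAt_matrix_inv (A z₀) (by
      rw [Ring.inverse_eq_inv']; exact continuousAt_inv₀ hdet)).comp hA.continuousAt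
  have hp : ContinuousAt p z₀ := by
    refine ContinuousAt.neg (continuousAt_pi.2 fun r => ?_)
    simp only [Matrix.mulVec, dotProduct]
    refine tendsto_finsetSum _ fun x _ => ?_
    exact (((continuous_apply_apply r x).continuousAt).comp hinv).mul
      (((continuous_apply x).comp hJ).continuousAt)
  refine ⟨fun z => P + ∑ x, p z x • B x.1 x.2, ?_, by simp [hp0], ?_⟩
  · refine continuousAt_const.add (tendsto_finsetSum _ fun x _ => ?_)
    exact (((continuous_apply x).continuousAt).comp hp).smul continuousAt_const
  · filter_upwards [hA.matrix_det.continuousAt.eventually_ne hdet] with z hz i m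
    have h1 : A z *ᵥ p z = - J z := by
      simp only [p, Matrix.mulVec_neg, Matrix.mulVec_mulVec]
      rw [Matrix.mul_nonsing_inv _ (isUnit_iff_ne_zero.2 hz), Matrix.one_mulVec]
    have h2 := congrFun h1 (i, m)
    simp only [A, J, Matrix.mulVec, dotProduct, Matrix.of_apply, Pi.neg_apply] at h2
    rw [toPoly_add_sum_smul]
    simp only [map_add, map_sum, map_smul, smul_eval]
    simp only [mul_comm (p z _), h2, add_neg_cancel]

end Deformation
section VerticalLines

open Polynomial in
/-- The restriction of `f` to the vertical line `x = a`. -/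
noncomputable def restrictVertical (a : ℂ) : MvPolynomial (Fin 2) ℂ →ₐ[ℂ] ℂ[X] :=
  aeval ![Polynomial.C a, Polynomial.X]

lemma eval_restrictVertical (a y : ℂ) (f : MvPolynomial (Fin 2) ℂ) :
    (restrictVertical a f).eval y = eval ![a, y] f := by
  induction f using MvPolynomial.induction_on with
  | C r => simp [restrictVertical]
  | add p q hp hq => simp [hp, hq]
  | mul_X p i hp => fin_cases i <;> simp [hp] <;> simp [restrictVertical]

lemma derivative_restrictVertical (a : ℂ) (f : MvPolynomial (Fin 2) ℂ) :
    (restrictVertical a f).derivative = restrictVertical a (pderiv 1 f) := by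
  induction f using MvPolynomial.induction_on with
  | C r => simp [restrictVertical]
  | add p q hp hq => simp [hp, hq]
  | mul_X p i hp =>
    fin_cases i <;> simp [hp, Derivation.leibniz, Polynomial.derivative_mul] <;>
      simp [restrictVertical] <;> ring

lemma natDegree_restrictVertical_le (a : ℂ) (f : MvPolynomial (Fin 2) ℂ) :
    (restrictVertical a f).natDegree ≤ degreeOf 1 f := by
  rw [restrictVertical, aeval_def, eval₂_eq']
  refine Polynomial.natDegree_sum_le_of_forall_le _ _ fun m hm => ?_
  refine le_trans ?_ (monomial_le_degreeOf 1 hm)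
  rw [Fin.prod_univ_two]
  simp only [Matrix.cons_val_zero, Matrix.cons_val_one, ← Polynomial.C_pow, ← mul_assoc,
    Polynomial.algebraMap_eq, ← Polynomial.C_mul]
  exact Polynomial.natDegree_C_mul_X_pow_le _ _

lemma X_sub_C_dvd_of_restrictVertical_eq_zero {a : ℂ} {f : MvPolynomial (Fin 2) ℂ}
    (h : restrictVertical a f = 0) : X 0 - C a ∣ f := by
  let I : Ideal (MvPolynomial (Fin 2) ℂ) := Ideal.span {X 0 - C a}
  have key : (((Ideal.Quotient.mkₐ ℂ I).comp (Polynomial.aeval (X 1))).comp (restrictVertical a)) =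
      Ideal.Quotient.mkₐ ℂ I := by
    refine MvPolynomial.algHom_ext fun i => ?_
    fin_cases i
    · simp only [restrictVertical, AlgHom.comp_apply, Fin.zero_eta, aeval_X, Matrix.cons_val_zero,
        Polynomial.aeval_C, Ideal.Quotient.mkₐ_eq_mk]
      refine (Ideal.Quotient.eq.2 (Ideal.mem_span_singleton.2 ?_)).symm
      rfl
    · simp [restrictVertical]
  have h1 := DFunLike.congr_fun key f
  simp only [AlgHom.comp_apply, h, map_zero] at h1
  exact Ideal.mem_span_singleton.1 (Ideal.Quotient.eq_zero_iff_mem.1 h1.symm)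

/-- An irreducible curve of degree at most `n` in `y` has at most `n / 2` singular points on a
vertical line. -/
lemma two_mul_card_singular_le {f : MvPolynomial (Fin 2) ℂ} (hf : Irreducible f) {a : ℂ}
    (S : Finset ℂ) (hS : ∀ y ∈ S, ∀ m, eval ![a, y] (jetOp m f) = 0) :
    2 * S.card ≤ degreeOf 1 f := by
  rcases S.eq_empty_or_nonempty with rfl | ⟨y₀, hy₀⟩
  · simp
  have hne : restrictVertical a f ≠ 0 := by
    intro h
    obtain ⟨u, hu⟩ := X_sub_C_dvd_of_restrictVertical_eq_zero h
    have h2 := ((jetOp_eq_zero_iff f _).1 (hS y₀ hy₀)).2.1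
    rw [hu] at h2
    simp [Derivation.leibniz] at h2
    have hunit : ¬ IsUnit (X 0 - C a : MvPolynomial (Fin 2) ℂ) := by
      intro h3
      simpa using h3.map (eval ![a, y₀])
    have h3 := ((hf.isUnit_or_isUnit hu).resolve_left hunit).map (eval ![a, y₀])
    exact h3.ne_zero h2
  refine le_trans ?_ (natDegree_restrictVertical_le a f)
  have hmult : ∀ y ∈ S, 2 ≤ (restrictVertical a f).roots.count y := by
    intro y hy
    obtain ⟨h0, -, h1⟩ := (jetOp_eq_zero_iff f _).1 (hS y hy)
    rw [Polynomial.count_roots]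
    refine (Polynomial.one_lt_rootMultiplicity_iff_isRoot hne).2 ⟨?_, ?_⟩
    · rw [Polynomial.IsRoot, eval_restrictVertical, h0]
    · rw [Polynomial.IsRoot, derivative_restrictVertical, eval_restrictVertical, h1]
  calc 2 * S.card = ∑ y ∈ S, 2 := by simp [mul_comm]
    _ ≤ ∑ y ∈ S, (restrictVertical a f).roots.count y := Finset.sum_le_sum hmult
    _ ≤ (restrictVertical a f).roots.card := by
      rw [← Multiset.toFinset_sum_count_eq]
      exact Finset.sum_le_sum_of_ne_zero fun y _ hy =>
        Multiset.mem_toFinset.2 (Multiset.count_ne_zero.1 hy)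
    _ ≤ _ := Polynomial.card_roots' _

end VerticalLines
section SeparatingPolynomials

variable {ι : Type*} [Fintype ι] [DecidableEq ι]

lemma degreeOf_X_sub_C_sq_self (i : Fin 2) (a : ℂ) :
    degreeOf i ((X i - C a : MvPolynomial (Fin 2) ℂ) ^ 2) ≤ 2 := by
  have h1 := degreeOf_pow_le i (X i - C a : MvPolynomial (Fin 2) ℂ) 2
  have h2 := degreeOf_sub_le i (X i : MvPolynomial (Fin 2) ℂ) (C a)
  rw [degreeOf_X_self, degreeOf_C] at h2
  omega

lemma degreeOf_X_sub_C_sq_of_ne {i j : Fin 2} (h : i ≠ j) (a : ℂ) :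
    degreeOf i ((X j - C a : MvPolynomial (Fin 2) ℂ) ^ 2) = 0 := by
  have h1 := degreeOf_pow_le i (X j - C a : MvPolynomial (Fin 2) ℂ) 2
  have h2 := degreeOf_sub_le i (X j : MvPolynomial (Fin 2) ℂ) (C a)
  rw [degreeOf_X_of_ne h, degreeOf_C] at h2
  omega

lemma degreeOf_affineMonomial_le (i : Fin 2) (m : Fin 3) : degreeOf i (affineMonomial m) ≤ 1 := by
  fin_cases m <;> fin_cases i <;> simp [affineMonomial, degreeOf_one, degreeOf_X]

lemma exists_toPoly_eq_affineMonomial_mul {a b : ℕ} {f : MvPolynomial (Fin 2) ℂ}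
    (h0 : degreeOf 0 f + 1 ≤ a) (h1 : degreeOf 1 f + 1 ≤ b) (m : Fin 3) :
    ∃ c : Coef (rectangle a b), toPoly c = affineMonomial m * f := by
  have e0 := degreeOf_mul_le 0 (affineMonomial m) f
  have e1 := degreeOf_mul_le 1 (affineMonomial m) f
  have d0 := degreeOf_affineMonomial_le 0 m
  have d1 := degreeOf_affineMonomial_le 1 m
  exact exists_toPoly_eq (by omega) (by omega)

/-- A linear polynomial vanishing at `z l` but not at `z j`. -/
noncomputable def separatingLine (z : ι → Fin 2 → ℂ) (j l : ι) : MvPolynomial (Fin 2) ℂ :=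
  if z l 0 = z j 0 then X 1 - C (z l 1) else X 0 - C (z l 0)

/-- A polynomial singular at all points of `z` except `z j`, where it does not vanish. -/
noncomputable def separatingPoly (z : ι → Fin 2 → ℂ) (j : ι) : MvPolynomial (Fin 2) ℂ :=
  ∏ l ∈ Finset.univ.erase j, separatingLine z j l ^ 2

lemma eval_separatingPoly_ne_zero {z : ι → Fin 2 → ℂ} (hz : Function.Injective z) (j : ι) :
    eval (z j) (separatingPoly z j) ≠ 0 := by
  rw [separatingPoly, map_prod, Finset.prod_ne_zero_iff]
  intro l hl
  have hlj := Finset.ne_of_mem_erase hl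
  rw [map_pow, separatingLine]
  refine pow_ne_zero 2 ?_
  split_ifs with h
  · simp only [map_sub, eval_X, eval_C]
    refine sub_ne_zero.2 fun h' => hlj (hz ?_)
    rw [funext_iff, Fin.forall_fin_two]
    exact ⟨h, h'.symm⟩
  · simpa using sub_ne_zero.2 (Ne.symm h)

lemma exists_separatingPoly_eq (z : ι → Fin 2 → ℂ) {i j : ι} (hij : j ≠ i) :
    ∃ a b, separatingPoly z j = a ^ 2 * b ∧ eval (z i) a = 0 := by
  refine ⟨separatingLine z j i, _, (Finset.mul_prod_erase _ _
    (Finset.mem_erase.2 ⟨hij.symm, Finset.mem_univ i⟩)).symm, ?_⟩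
  rw [separatingLine]
  split_ifs <;> simp

lemma degreeOf_zero_separatingPoly_le (z : ι → Fin 2 → ℂ) (j : ι) :
    degreeOf 0 (separatingPoly z j) ≤ 2 * (Fintype.card ι - 1) := by
  refine (degreeOf_prod_le _ _ _).trans ?_
  have : ∀ l ∈ Finset.univ.erase j, degreeOf 0 (separatingLine z j l ^ 2) ≤ 2 := by
    intro l _
    rw [separatingLine]
    split_ifs
    · rw [degreeOf_X_sub_C_sq_of_ne zero_ne_one]; omega
    · exact degreeOf_X_sub_C_sq_self 0 _
  refine (Finset.sum_le_card_nsmul _ _ _ this).trans ?_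
  rw [Finset.card_erase_of_mem (Finset.mem_univ j), Finset.card_univ, smul_eq_mul, mul_comm]

lemma degreeOf_one_separatingPoly_le (z : ι → Fin 2 → ℂ) (j : ι) :
    degreeOf 1 (separatingPoly z j) ≤
      2 * ((Finset.univ.erase j).filter fun l => z l 0 = z j 0).card := by
  refine (degreeOf_prod_le _ _ _).trans ?_
  rw [mul_comm, ← smul_eq_mul, ← Finset.sum_const, Finset.sum_filter]
  refine Finset.sum_le_sum fun l _ => ?_
  rw [separatingLine]
  split_ifs
  · exact degreeOf_X_sub_C_sq_self 1 _
  · rw [degreeOf_X_sub_C_sq_of_ne one_ne_zero]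

/-- A polynomial singular at all points of `z`. -/
noncomputable def singularPoly (z : ι → Fin 2 → ℂ) (j : ι) : MvPolynomial (Fin 2) ℂ :=
  (X 1 - C (z j 1)) ^ 2 * separatingPoly z j

lemma eval_jetOp_affinePoly_mul_singularPoly (z : ι → Fin 2 → ℂ) (i j : ι) (c : Fin 3 → ℂ)
    (m : Fin 3) : eval (z i) (jetOp m (affinePoly c * singularPoly z j)) = 0 := by
  by_cases hij : j = i
  · subst hij
    rw [singularPoly, mul_left_comm]
    exact eval_jetOp_sq_mul (by simp) m
  · obtain ⟨a, b, hab, ha⟩ := exists_separatingPoly_eq z hij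
    rw [singularPoly, hab, mul_left_comm (_ ^ 2), mul_left_comm]
    exact eval_jetOp_sq_mul ha m

lemma degreeOf_zero_singularPoly_le (z : ι → Fin 2 → ℂ) (j : ι) :
    degreeOf 0 (singularPoly z j) ≤ 2 * (Fintype.card ι - 1) := by
  have h1 := degreeOf_mul_le 0 ((X 1 - C (z j 1)) ^ 2) (separatingPoly z j)
  rw [degreeOf_X_sub_C_sq_of_ne zero_ne_one, zero_add] at h1
  exact h1.trans (degreeOf_zero_separatingPoly_le z j)

lemma degreeOf_one_singularPoly_le {z : ι → Fin 2 → ℂ} (hz : ∀ i j, i ≠ j → z i 0 ≠ z j 0)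
    (j : ι) : degreeOf 1 (singularPoly z j) ≤ 2 := by
  have h1 := degreeOf_mul_le 1 ((X 1 - C (z j 1)) ^ 2) (separatingPoly z j)
  have h2 := degreeOf_one_separatingPoly_le z j
  rw [← singularPoly] at h1
  rw [Finset.card_eq_zero.2 (Finset.filter_eq_empty_iff.2 fun l hl =>
    hz l j (Finset.ne_of_mem_erase hl))] at h2
  have h3 := degreeOf_X_sub_C_sq_self 1 (z j 1)
  omega

lemma eval_singularPoly_eq_zero_iff {z : ι → Fin 2 → ℂ} (hz : ∀ i j, i ≠ j → z i 0 ≠ z j 0)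
    (j : ι) (w : Fin 2 → ℂ) :
    eval w (singularPoly z j) = 0 ↔ w 1 = z j 1 ∨ ∃ l, l ≠ j ∧ w 0 = z l 0 := by
  have : ∀ l ∈ Finset.univ.erase j, separatingLine z j l ^ 2 = (X 0 - C (z l 0)) ^ 2 :=
    fun l hl => by rw [separatingLine, if_neg (hz l j (Finset.ne_of_mem_erase hl))]
  rw [singularPoly, separatingPoly, Finset.prod_congr rfl this]
  simp [Finset.prod_eq_zero_iff, sub_eq_zero]

/-- The common zeros of the polynomials `singularPoly z j` are the points of `z`. -/
lemma exists_eval_singularPoly_ne_zero [Nontrivial ι] {z : ι → Fin 2 → ℂ}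
    (hz : ∀ i j, i ≠ j → z i 0 ≠ z j 0 ∧ z i 1 ≠ z j 1) {w : Fin 2 → ℂ} (hw : ∀ i, w ≠ z i) :
    ∃ j, eval w (singularPoly z j) ≠ 0 := by
  by_contra! h
  simp only [eval_singularPoly_eq_zero_iff fun i j hij => (hz i j hij).1] at h
  have key : ∃ j, ∀ l, l ≠ j → w 0 ≠ z l 0 := by
    by_cases hex : ∃ j, w 0 = z j 0
    · obtain ⟨j, hj⟩ := hex
      exact ⟨j, fun l hl h' => (hz l j hl).1 (h'.symm.trans hj)⟩
    · push Not at hex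
      obtain ⟨j⟩ : Nonempty ι := inferInstance
      exact ⟨j, fun l _ => hex l⟩
  obtain ⟨j, hj⟩ := key
  have hj1 : w 1 = z j 1 := (h j).resolve_right fun ⟨l, hl, hl'⟩ => hj l hl hl'
  obtain ⟨i, hi⟩ := exists_ne j
  rcases h i with h1 | ⟨l, hl, hl'⟩
  · exact (hz i j hi).2 (h1.symm.trans hj1)
  · have hlj : l = j := by
      by_contra hne
      exact hj l hne hl'
    subst hlj
    refine hw l ?_
    rw [funext_iff, Fin.forall_fin_two]
    exact ⟨hl', hj1⟩

end SeparatingPolynomials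

section Configurations

open Topology

lemma isOpen_distinct_coordinates {ι : Type*} [Finite ι] :
    IsOpen {z : ι → Fin 2 → ℂ | ∀ i j, i ≠ j → z i 0 ≠ z j 0 ∧ z i 1 ≠ z j 1} := by
  simp only [Set.ofPred_forall]
  refine isOpen_iInter_of_finite fun i => isOpen_iInter_of_finite fun j =>
    isOpen_iInter_of_finite fun _ => ?_
  have h : ∀ m : Fin 2, IsOpen {z : ι → Fin 2 → ℂ | z i m ≠ z j m} := fun m =>
    isOpen_ne_fun (continuous_apply_apply i m) (continuous_apply_apply j m)
  exact (h 0).inter (h 1)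

lemma eventually_add_mul_ne {a b c d : ℂ} (hcd : c ≠ d) :
    ∀ᶠ t in 𝓝[≠] (0 : ℂ), a + t * c ≠ b + t * d := by
  by_cases hab : a = b
  · filter_upwards [self_mem_nhdsWithin] with t ht h
    subst hab
    exact hcd (mul_left_cancel₀ ht (add_left_cancel h))
  · refine (ContinuousAt.eventually_ne (g := fun t : ℂ => (a + t * c) - (b + t * d)) (y := 0)
      (by fun_prop) (by simpa using sub_ne_zero.2 hab)).filter_mono nhdsWithin_le_nhds |>.mono ?_
    exact fun t ht => sub_ne_zero.1 ht

lemma exists_mem_distinct_coordinates {n : ℕ} {z₀ : Fin n → Fin 2 → ℂ}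
    {O : Set (Fin n → Fin 2 → ℂ)} (hO : O ∈ 𝓝 z₀) :
    ∃ z ∈ O, ∀ i j, i ≠ j → z i 0 ≠ z j 0 ∧ z i 1 ≠ z j 1 := by
  let γ : ℂ → Fin n → Fin 2 → ℂ := fun t i m => z₀ i m + t * (i : ℕ)
  have hγ : Continuous γ := by fun_prop
  have h1 : ∀ᶠ t in 𝓝[≠] (0 : ℂ), γ t ∈ O := by
    refine (hγ.continuousAt.eventually_mem ?_).filter_mono nhdsWithin_le_nhds
    convert hO
    simp [γ]
  have h2 : ∀ᶠ t in 𝓝[≠] (0 : ℂ), ∀ i j : Fin n, i ≠ j →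
      γ t i 0 ≠ γ t j 0 ∧ γ t i 1 ≠ γ t j 1 := by
    simp only [Filter.eventually_all]
    intro i j hij
    have hij' : ((i : ℕ) : ℂ) ≠ (j : ℕ) := by
      simpa [Fin.ext_iff] using hij
    exact (eventually_add_mul_ne hij').and (eventually_add_mul_ne hij')
  obtain ⟨t, ht1, ht2⟩ := (h1.and h2).exists
  exact ⟨γ t, ht1, ht2⟩

end Configurations

/-- The determinant of the Hessian of `f` at `w`. -/
noncomputable def hessianDet (w : Fin 2 → ℂ) (f : MvPolynomial (Fin 2) ℂ) : ℂ :=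
  eval w (pderiv 0 (pderiv 0 f)) * eval w (pderiv 1 (pderiv 1 f)) -
    eval w (pderiv 0 (pderiv 1 f)) * eval w (pderiv 1 (pderiv 0 f))

lemma continuous_hessianDet_toPoly {L : Finset (ℕ × ℕ)} :
    Continuous fun x : (Fin 2 → ℂ) × Coef L => hessianDet x.1 (toPoly x.2) := by
  have h : ∀ i j : Fin 2, Continuous fun x : (Fin 2 → ℂ) × Coef L =>
      eval x.1 (pderiv i (pderiv j (toPoly x.2))) := fun i j =>
    continuous_eval_toPoly ((pderiv i : Derivation ℂ _ _).toLinearMap ∘ₗ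
      (pderiv j : Derivation ℂ (MvPolynomial (Fin 2) ℂ) _).toLinearMap)
  exact ((h 0 0).mul (h 1 1)).sub ((h 0 1).mul (h 1 0))

lemma isOpen_forall_ne_zero {ι Y : Type*} [Finite ι] [TopologicalSpace Y]
    {g : (Fin 2 → ℂ) × Y → ℂ} (hg : Continuous g) :
    IsOpen {x : (ι → Fin 2 → ℂ) × Y |
      ∀ i, (x.1 i 0 ≠ 0 ∧ x.1 i 1 ≠ 0) ∧ g (x.1 i, x.2) ≠ 0} := by
  simp only [Set.ofPred_forall]
  refine isOpen_iInter_of_finite fun i => ?_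
  have hi : Continuous fun x : (ι → Fin 2 → ℂ) × Y => (x.1 i, x.2) := by fun_prop
  have hc : ∀ m : Fin 2, IsOpen {x : (ι → Fin 2 → ℂ) × Y | x.1 i m ≠ 0} := fun m =>
    isOpen_ne_fun (by fun_prop) continuous_const
  exact ((hc 0).inter (hc 1)).inter (isOpen_ne_fun (hg.comp hi) continuous_const)

lemma degreeOf_one_toPoly_le {a b : ℕ} (c : Coef (rectangle a b)) :
    degreeOf 1 (toPoly c) ≤ b := by
  rw [degreeOf_le_iff]
  intro m hm
  rw [mem_support_iff, coeff_toPoly] at hm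
  split_ifs at hm with h
  · simp [rectangle] at h; omega
  · exact absurd rfl hm

lemma isSingAt_iff {f : MvPolynomial (Fin 2) ℂ} {w : Fin 2 → ℂ} :
    IsSingAt f w ↔ (w 0 ≠ 0 ∧ w 1 ≠ 0) ∧ ∀ m, eval w (jetOp m f) = 0 := by
  rw [jetOp_eq_zero_iff, IsSingAt, and_assoc]

/-- An irreducible curve of degree at most `4` in `y` has at most two singular points on each
vertical line. -/
lemma card_filter_same_abscissa_le {ι : Type*} [Fintype ι] [DecidableEq ι]
    {f : MvPolynomial (Fin 2) ℂ} (hf : Irreducible f) (hdeg : degreeOf 1 f ≤ 4)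
    {z : ι → Fin 2 → ℂ} (hz : Function.Injective z)
    (hsing : ∀ i m, eval (z i) (jetOp m f) = 0) (j : ι) :
    ((Finset.univ.erase j).filter fun l => z l 0 = z j 0).card ≤ 1 := by
  let T := Finset.univ.filter fun l => z l 0 = z j 0
  have hT : (T.image fun l => z l 1).card = T.card := by
    refine Finset.card_image_of_injOn fun l hl l' hl' h => hz ?_
    rw [funext_iff, Fin.forall_fin_two]
    exact ⟨(Finset.mem_filter.1 hl).2.trans (Finset.mem_filter.1 hl').2.symm, h⟩
  have h1 := two_mul_card_singular_le hf (a := z j 0) (T.image fun l => z l 1) (by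
    intro y hy m
    obtain ⟨l, hl, rfl⟩ := Finset.mem_image.1 hy
    have : z l = ![z j 0, z l 1] := by
      rw [funext_iff, Fin.forall_fin_two]
      exact ⟨(Finset.mem_filter.1 hl).2, rfl⟩
    rw [← this]
    exact hsing l m)
  have hj : j ∈ T := by simp [T]
  have h2 : ((Finset.univ.erase j).filter fun l => z l 0 = z j 0) = T.erase j := by
    rw [Finset.filter_erase]
  rw [h2, Finset.card_erase_of_mem hj]
  omega

/-- A polynomial with nodes at points with pairwise distinct coordinates can be perturbed so that
it has no other singularities. -/
lemma exists_perturbation_only_nodes {n a : ℕ} (hn : 2 ≤ n) (ha : 2 * n ≤ a + 1)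
    {z : Fin n → Fin 2 → ℂ} (hz : ∀ i j, i ≠ j → z i 0 ≠ z j 0 ∧ z i 1 ≠ z j 1)
    {Q : Coef (rectangle a 4)} (hQ : ∀ i m, eval (z i) (jetOp m (toPoly Q)) = 0)
    {W : Set (Coef (rectangle a 4))} (hW : IsOpen W) (hQW : Q ∈ W) :
    ∃ R ∈ W, (∀ i m, eval (z i) (jetOp m (toPoly R)) = 0) ∧
      ∀ w, (∀ m, eval w (jetOp m (toPoly R)) = 0) → ∃ i, w = z i := by
  have : Nontrivial (Fin n) := Fin.nontrivial_iff_two_le.2 hn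
  have hB : ∀ j m, ∃ c : Coef (rectangle a 4), toPoly c = affineMonomial m * singularPoly z j := by
    intro j m
    have h0 := degreeOf_zero_singularPoly_le z j
    have h1 := degreeOf_one_singularPoly_le (fun i j hij => (hz i j hij).1) j
    rw [Fintype.card_fin] at h0
    exact exists_toPoly_eq_affineMonomial_mul (by omega) (by omega) m
  choose B hB using hB
  let Φ : (Fin n → Fin 3 → ℂ) → Coef (rectangle a 4) := fun p =>
    Q + ∑ x : Fin n × Fin 3, p x.1 x.2 • B x.1 x.2
  have hΦ : Continuous Φ := by fun_prop
  have hΦ' : ∀ p, toPoly (Φ p) = toPoly Q + ∑ j, affinePoly (p j) * singularPoly z j := by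
    intro p
    rw [toPoly_add_sum_smul Q (fun x : Fin n × Fin 3 => p x.1 x.2), Fintype.sum_prod_type]
    simp only [hB, affinePoly, Finset.sum_mul, smul_mul_assoc]
  obtain ⟨p, hp, hpW⟩ := (dense_nonsingular (toPoly Q) (singularPoly z)).exists_mem_open
    (hW.preimage hΦ) ⟨0, by simpa [Φ] using hQW⟩
  refine ⟨Φ p, hpW, fun i m => ?_, fun w hw => ?_⟩
  · simp [hΦ', hQ, eval_jetOp_affinePoly_mul_singularPoly]
  · by_contra! hne
    refine hp w (exists_eval_singularPoly_ne_zero hz hne) fun m => ?_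
    rw [← hΦ']
    exact hw m

/-- Let `P` be a real polynomial of bidegree `(4k,4)` defining an
irreducible curve whose only singularities are `2k` nondegenerate double points in
`(ℂ*)²`. Then the double points can be brought into general position by a perturbation
of `P`: for the incidence variety `I` of nearby polynomials together with their `2k`
double points, the image of `I` under the projection to the configuration space
`((ℂ*)²)^{2k}` has (full) dimension `4k`, i.e. it contains a nonempty open subset. -/
theorem double_points_in_general_position
    (k : ℕ) (hk : 0 < k)
    (P0 : Coef (rectangle (4 * k) 4))
    -- `P` is real:
    (hreal : ∀ p, (P0 p).im = 0)
    (hirr : Irreducible (toPoly P0))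
    (z0 : Fin (2 * k) → (Fin 2 → ℂ)) (hz0inj : Function.Injective z0)
    (hnodes : ∀ i, IsNodeAt (toPoly P0) (z0 i))
    (honly : ∀ w : Fin 2 → ℂ, IsSingAt (toPoly P0) w → ∃ i, w = z0 i) :
    -- for every neighborhood `U` of `P₀` in the space of polynomials of bidegree
    -- `(4k,4)`, the image of the incidence variety `I` over `U` under the second
    -- projection contains a nonempty open subset of the configuration space:
    ∀ U : Set (Coef (rectangle (4 * k) 4)), IsOpen U → P0 ∈ U →
      ∃ V : Set (Fin (2 * k) → (Fin 2 → ℂ)), IsOpen V ∧ V.Nonempty ∧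
        V ⊆ {z | ∃ Q ∈ U, Function.Injective z ∧
          (∀ i, IsNodeAt (toPoly Q) (z i)) ∧
          (∀ w : Fin 2 → ℂ, IsSingAt (toPoly Q) w → ∃ i, w = z i)} := by
  intro U hU hPU
  have hsing : ∀ i m, eval (z0 i) (jetOp m (toPoly P0)) = 0 := fun i =>
    (isSingAt_iff.1 (hnodes i).1).2
  obtain ⟨q, hq, hq0, hqsing⟩ := exists_continuous_deformation P0 z0 hsing (separatingPoly z0)
    (eval_separatingPoly_ne_zero hz0inj) (fun i j hij => exists_separatingPoly_eq z0 hij) (by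
      intro j m
      have h0 := degreeOf_zero_separatingPoly_le z0 j
      have h1 := degreeOf_one_separatingPoly_le z0 j
      have h2 := card_filter_same_abscissa_le hirr (degreeOf_one_toPoly_le P0) hz0inj hsing j
      rw [Fintype.card_fin] at h0
      exact exists_toPoly_eq_affineMonomial_mul (by omega) (by omega) m)
  let N : Set ((Fin (2 * k) → Fin 2 → ℂ) × Coef (rectangle (4 * k) 4)) :=
    {x | x.2 ∈ U ∧ ∀ i, (x.1 i 0 ≠ 0 ∧ x.1 i 1 ≠ 0) ∧ hessianDet (x.1 i) (toPoly x.2) ≠ 0}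
  have hN : IsOpen N := (hU.preimage continuous_snd).inter
    (isOpen_forall_ne_zero continuous_hessianDet_toPoly)
  have hN0 : (z0, q z0) ∈ N := by
    rw [hq0]
    exact ⟨hPU, fun i => ⟨⟨(hnodes i).1.1, (hnodes i).1.2.1⟩, (hnodes i).2⟩⟩
  have hev := hqsing.and ((continuousAt_id.prodMk hq).eventually_mem (hN.mem_nhds hN0))
  obtain ⟨O, hO, hOopen, hz0O⟩ := mem_nhds_iff.1 hev
  obtain ⟨z1, hz1, hz1'⟩ := exists_mem_distinct_coordinates (hOopen.mem_nhds hz0O)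
  refine ⟨O ∩ {z | ∀ i j, i ≠ j → z i 0 ≠ z j 0 ∧ z i 1 ≠ z j 1},
    hOopen.inter isOpen_distinct_coordinates, ⟨z1, hz1, hz1'⟩, ?_⟩
  rintro z ⟨hzO, hz⟩
  obtain ⟨hzsing, hzN⟩ := hO hzO
  obtain ⟨R, hRN, hR, hR'⟩ := exists_perturbation_only_nodes (by omega) (by omega) hz hzsing
    (hN.preimage (Continuous.prodMk_right z)) hzN
  refine ⟨R, hRN.1, ?_, fun i => ⟨?_, (hRN.2 i).2⟩, fun w hw => hR' w (isSingAt_iff.1 hw).2⟩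
  · intro i j hij
    by_contra hne
    exact (hz i j hne).1 (congrFun hij 0)
  · exact isSingAt_iff.2 ⟨(hRN.2 i).1, hR i⟩
end
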